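/- arXiv:2510.17791 — 7 statements merged into one kernel-verified Lean document; each statement's English description precedes it below -/
import Mathlib

section
/- Let a be an integer with a ≡ 0 (mod 3). Then the torsion subgroup of the Mordell–Weil group E_a(ℚ) is isomorphic to (ℤ/2ℤ) × (ℤ/2ℤ). -/
/-- The elliptic curve `E_a : y² = x³ + 2a²x² + (a⁴ - 4)x` over `ℚ`. -/
noncomputable def Ea (a : ℤ) : WeierstrassCurve ℚ :=
  { a₁ := 0, a₂ := 2 * (a : ℚ) ^ 2, a₃ := 0, a₄ := (a : ℚ) ^ 4 - 4, a₆ := 0 }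

open WeierstrassCurve WeierstrassCurve.Affine

namespace Ea

section Padic

@[simp, norm_cast]
lemma coe_ofNat_padicInt (n : ℕ) [n.AtLeastTwo] :
    ((ofNat(n) : ℤ_[3]) : ℚ_[3]) = ofNat(n) :=
  map_ofNat (PadicInt.Coe.ringHom (p := 3)) n

lemma toZMod_eq_zero_iff {z : ℤ_[3]} : PadicInt.toZMod z = 0 ↔ ‖z‖ < 1 := by
  rw [← RingHom.mem_ker, PadicInt.ker_toZMod, IsLocalRing.mem_maximalIdeal, PadicInt.mem_nonunits]

lemma norm_eq_one_of_toZMod_ne_zero {z : ℤ_[3]} (hz : PadicInt.toZMod z ≠ 0) : ‖z‖ = 1 :=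
  z.norm_le_one.eq_of_not_lt fun h ↦ hz (toZMod_eq_zero_iff.mpr h)

/-- The inverse of a non-integral `3`-adic number is a `3`-adic integer divisible by `3`. -/
lemma exists_three_mul_mul_eq_one {x : ℚ_[3]} (hx : 1 < ‖x‖) : ∃ w : ℤ_[3], 3 * w * x = 1 := by
  have hx0 : x ≠ 0 := norm_pos_iff.mp (by linarith)
  have hu : ‖x⁻¹‖ < 1 := by rw [norm_inv]; exact inv_lt_one_of_one_lt₀ hx
  obtain ⟨w, hw⟩ := (PadicInt.norm_lt_one_iff_dvd (p := 3) ⟨x⁻¹, hu.le⟩).mp hu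
  refine ⟨w, ?_⟩
  have h : x⁻¹ = 3 * w := by
    have := congrArg (fun z : ℤ_[3] ↦ (z : ℚ_[3])) hw
    simpa using this
  rw [← h, inv_mul_cancel₀ hx0]

lemma zmod_three_eq_zero : (3 : ZMod 3) = 0 := rfl

lemma cubic_ne_zero_of_one_lt_norm (c : ℤ) {x : ℚ_[3]} (hx : 1 < ‖x‖) :
    x ^ 3 + 2 * (3 * c) ^ 2 * x ^ 2 + ((3 * c) ^ 4 - 4) * x ≠ 0 := by
  obtain ⟨w, hw⟩ := exists_three_mul_mul_eq_one hx
  set f : ℤ_[3] := 1 + 2 * (3 * c) ^ 2 * (3 * w) + ((3 * c) ^ 4 - 4) * (3 * w) ^ 2 with hf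
  have hf1 : ‖f‖ = 1 := norm_eq_one_of_toZMod_ne_zero (by simp [hf, map_ofNat, zmod_three_eq_zero])
  intro h
  have h0 : (f : ℚ_[3]) = 0 := by
    have : (f : ℚ_[3]) = (3 * w) ^ 3 *
        (x ^ 3 + 2 * (3 * c) ^ 2 * x ^ 2 + ((3 * c) ^ 4 - 4) * x) := by
      simp only [hf]; push_cast
      linear_combination (-(3 * w * x) ^ 2 - (3 * w * x) - 1 -
        2 * (3 * c) ^ 2 * (3 * w) * (3 * w * x + 1) - ((3 * c) ^ 4 - 4) * (3 * w) ^ 2 : ℚ_[3]) * hw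
    rw [this, h, mul_zero]
  simp [PadicInt.norm_def, h0] at hf1

/-- If `x` is not `3`-integral, the `x`-coordinate of twice a point with `x`-coordinate `x`
is not `3`-integral. -/
lemma one_lt_norm_double_of_one_lt_norm (c : ℤ) {x y X : ℚ_[3]} (hx : 1 < ‖x‖)
    (hy : y ^ 2 = x ^ 3 + 2 * (3 * c) ^ 2 * x ^ 2 + ((3 * c) ^ 4 - 4) * x)
    (hX : X * (4 * y ^ 2) = (x ^ 2 - ((3 * c) ^ 4 - 4)) ^ 2) : 1 < ‖X‖ := by
  obtain ⟨w, hw⟩ := exists_three_mul_mul_eq_one hx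
  set f : ℤ_[3] := 4 * (1 + 2 * (3 * c) ^ 2 * (3 * w) + ((3 * c) ^ 4 - 4) * (3 * w) ^ 2) with hf
  set g : ℤ_[3] := (1 - ((3 * c) ^ 4 - 4) * (3 * w) ^ 2) ^ 2 with hg
  have hf1 : ‖f‖ = 1 := norm_eq_one_of_toZMod_ne_zero (by simp [hf, map_ofNat, zmod_three_eq_zero]; decide)
  have hg1 : ‖g‖ = 1 := norm_eq_one_of_toZMod_ne_zero (by simp [hg, map_ofNat, zmod_three_eq_zero])
  have h3w : ‖(3 * w : ℚ_[3])‖ * ‖x‖ = 1 := by rw [← norm_mul, hw, norm_one]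
  have key : X * (3 * w) * f = g := by
    have hw' : (3 * w : ℚ_[3]) ≠ 0 := left_ne_zero_of_mul (hw ▸ one_ne_zero)
    have hxw : x = (3 * w : ℚ_[3])⁻¹ := eq_inv_of_mul_eq_one_right hw
    rw [hy] at hX
    simp only [hf, hg]; push_cast
    generalize (3 * w : ℚ_[3]) = u at *
    subst hxw
    field_simp at hX
    linear_combination hX
  have h := congrArg norm key
  rw [norm_mul, norm_mul, ← PadicInt.norm_def, ← PadicInt.norm_def, hf1, hg1, mul_one] at h
  have hpos : 0 < ‖(3 * w : ℚ_[3])‖ := by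
    rw [norm_pos_iff]; exact left_ne_zero_of_mul (hw ▸ one_ne_zero)
  have : ‖X‖ = ‖x‖ := mul_right_cancel₀ hpos.ne' (by linarith)
  rwa [this]

lemma one_lt_norm_double_of_norm_le_one (c : ℤ) {x y X : ℚ_[3]} (hx : ‖x‖ ≤ 1) (hy0 : y ≠ 0)
    (hy : y ^ 2 = x ^ 3 + 2 * (3 * c) ^ 2 * x ^ 2 + ((3 * c) ^ 4 - 4) * x)
    (hX : X * (4 * y ^ 2) = (x ^ 2 - ((3 * c) ^ 4 - 4)) ^ 2) : 1 < ‖X‖ := by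
  obtain ⟨x, rfl⟩ : ∃ z : ℤ_[3], (z : ℚ_[3]) = x := ⟨⟨x, hx⟩, rfl⟩
  set f : ℤ_[3] := x ^ 3 + 2 * (3 * c) ^ 2 * x ^ 2 + ((3 * c) ^ 4 - 4) * x with hf
  set g : ℤ_[3] := (x ^ 2 - ((3 * c) ^ 4 - 4)) ^ 2 with hg
  have hf1 : ‖f‖ < 1 := by
    rw [← toZMod_eq_zero_iff]
    simp only [hf, map_add, map_mul, map_sub, map_pow, map_intCast, map_ofNat, zmod_three_eq_zero]
    generalize PadicInt.toZMod x = t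
    simp only [zero_mul, mul_zero, ne_eq, OfNat.ofNat_ne_zero, not_false_eq_true, zero_pow]
    revert t; decide
  have hg1 : ‖g‖ = 1 := by
    apply norm_eq_one_of_toZMod_ne_zero
    simp only [hg, map_mul, map_sub, map_pow, map_intCast, map_ofNat, zmod_three_eq_zero]
    generalize PadicInt.toZMod x = t
    simp only [zero_mul, ne_eq, OfNat.ofNat_ne_zero, not_false_eq_true, zero_pow]
    revert t; decide
  have h4 : ‖(4 : ℤ_[3])‖ = 1 :=
    norm_eq_one_of_toZMod_ne_zero (by rw [map_ofNat]; decide)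
  have key : X * ((4 : ℤ_[3]) * f) = g := by
    rw [hy] at hX
    simp only [hf, hg]; push_cast
    exact hX
  have hfy : (f : ℚ_[3]) = y ^ 2 := by rw [hy, hf]; push_cast; rfl
  have hf0 : 0 < ‖f‖ := by
    rw [PadicInt.norm_def, hfy, norm_pos_iff]; exact pow_ne_zero 2 hy0
  have h := congrArg norm key
  rw [norm_mul, norm_mul, ← PadicInt.norm_def, ← PadicInt.norm_def, ← PadicInt.norm_def, h4, hg1,
    one_mul] at h
  by_contra! hle
  nlinarith [norm_nonneg X]

/-- The `3`-division polynomial does not vanish at non-integral `x`, and tripling a point with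
non-integral `x`-coordinate strictly increases the norm of the `x`-coordinate. -/
lemma norm_triple (c : ℤ) {x : ℚ_[3]} (hx : 1 < ‖x‖) {A B s f : ℚ_[3]}
    (hA : A = 2 * (3 * c) ^ 2) (hB : B = (3 * c) ^ 4 - 4)
    (hs : s = 3 * x ^ 4 + 4 * A * x ^ 3 + 6 * B * x ^ 2 - B ^ 2)
    (hf : f = x ^ 3 + A * x ^ 2 + B * x) :
    s ≠ 0 ∧ ∀ X, X * s ^ 2 =
      x * s ^ 2 + 64 * f ^ 3 - 8 * f * (3 * x ^ 2 + 2 * A * x + B) * s → ‖x‖ < ‖X‖ := by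
  obtain ⟨w, hw⟩ := exists_three_mul_mul_eq_one hx
  obtain ⟨A', hA'⟩ : ∃ A' : ℤ_[3], A' = 6 * c ^ 2 := ⟨_, rfl⟩
  obtain ⟨B', hB'⟩ : ∃ B' : ℤ_[3], B' = (3 * c) ^ 4 - 4 := ⟨_, rfl⟩
  have hAA : A = 3 * A' := by rw [hA, hA']; push_cast; ring
  have hBB : B = B' := by rw [hB, hB']; push_cast; ring
  set σ : ℤ_[3] := 1 + 3 * (4 * A' * w + 6 * B' * w ^ 2 - 9 * B' ^ 2 * w ^ 4) with hσ
  set φ : ℤ_[3] := 64 * (1 + 3 * A' * (3 * w) + B' * (3 * w) ^ 2) ^ 3 + 3 * (3 * σ ^ 2 -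
    8 * (1 + 3 * A' * (3 * w) + B' * (3 * w) ^ 2) *
      (3 + 6 * A' * (3 * w) + B' * (3 * w) ^ 2) * σ) with hφ
  have hσ1 : ‖σ‖ = 1 := norm_eq_one_of_toZMod_ne_zero (by simp [hσ, map_ofNat, zmod_three_eq_zero])
  have hφ1 : ‖φ‖ = 1 := norm_eq_one_of_toZMod_ne_zero (by simp [hφ, map_ofNat, zmod_three_eq_zero]; decide)
  have hw' : (3 * w : ℚ_[3]) ≠ 0 := left_ne_zero_of_mul (hw ▸ one_ne_zero)
  have hxw : x = (3 * w : ℚ_[3])⁻¹ := eq_inv_of_mul_eq_one_right hw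
  have hsσ : s * (3 * w) ^ 4 = 3 * σ := by
    rw [hs, hσ, hAA, hBB]; push_cast
    generalize hu : (3 * w : ℚ_[3]) = u at *
    rw [hxw]
    field_simp
    linear_combination (-12 * A' - 18 * B' * (u + 3 * w) / 3 +
      B' ^ 2 * (u + 3 * w) * (u ^ 2 + (3 * w) ^ 2)) * hu
  have hσ0 : (σ : ℚ_[3]) ≠ 0 := by
    rw [← norm_pos_iff, ← PadicInt.norm_def, hσ1]; exact one_pos
  refine ⟨fun h0 ↦ ?_, fun X hX ↦ ?_⟩
  · rw [h0, zero_mul] at hsσ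
    exact mul_ne_zero (by norm_num) hσ0 hsσ.symm
  have key : X * (9 * σ ^ 2) = x * φ := by
    have hff : f * (3 * w) ^ 3 = 1 + A * (3 * w) + B * (3 * w) ^ 2 := by
      generalize (3 * w : ℚ_[3]) = u at *
      rw [hf, hxw]; field_simp
    have hgg : (3 * x ^ 2 + 2 * A * x + B) * (3 * w) ^ 2 =
        3 + 2 * A * (3 * w) + B * (3 * w) ^ 2 := by
      generalize (3 * w : ℚ_[3]) = u at *
      rw [hxw]; field_simp
    have hφ' : (φ : ℚ_[3]) = 64 * (f * (3 * w) ^ 3) ^ 3 + (s * (3 * w) ^ 4) ^ 2 -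
        8 * (f * (3 * w) ^ 3) * ((3 * x ^ 2 + 2 * A * x + B) * (3 * w) ^ 2) *
          (s * (3 * w) ^ 4) := by
      rw [hff, hgg, hsσ, hφ, hAA, hBB]; push_cast; ring
    have : (9 * σ ^ 2 : ℚ_[3]) = (s * (3 * w) ^ 4) ^ 2 := by rw [hsσ]; ring
    rw [hφ', this]
    generalize (3 * x ^ 2 + 2 * A * x + B) = g at *
    generalize (3 * w : ℚ_[3]) = u at *
    linear_combination u ^ 8 * hX - (64 * f ^ 3 - 8 * f * g * s) * u ^ 8 * hw
  have h9 : ‖(9 : ℚ_[3])‖ < 1 := by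
    have : ‖((9 : ℤ) : ℚ_[3])‖ < 1 := (Padic.norm_intCast_lt_one_iff).mpr (by norm_num)
    simpa using this
  have h := congrArg norm key
  rw [norm_mul, norm_mul, norm_mul, norm_pow, ← PadicInt.norm_def, ← PadicInt.norm_def, hσ1, hφ1]
    at h
  by_contra! hle
  nlinarith [norm_nonneg X, norm_nonneg (9 : ℚ_[3])]

end Padic

section Formulas

variable {K : Type*} [Field K] [CharZero K]

lemma double_x_formula {A B x y X ℓ : K} (hy0 : y ≠ 0) (hy : y ^ 2 = x ^ 3 + A * x ^ 2 + B * x)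
    (hℓ : ℓ = (3 * x ^ 2 + 2 * A * x + B) / (2 * y)) (hX : X = ℓ ^ 2 - A - x - x) :
    X * (4 * y ^ 2) = (x ^ 2 - B) ^ 2 := by
  subst hX hℓ
  field_simp
  linear_combination (-16 * A - 32 * x) * hy

lemma double_x_sub {A B x y X ℓ : K} (hy0 : y ≠ 0) (hy : y ^ 2 = x ^ 3 + A * x ^ 2 + B * x)
    (hℓ : ℓ = (3 * x ^ 2 + 2 * A * x + B) / (2 * y)) (hX : X = ℓ ^ 2 - A - x - x) :
    (X - x) * (4 * y ^ 2) = -(3 * x ^ 4 + 4 * A * x ^ 3 + 6 * B * x ^ 2 - B ^ 2) := by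
  linear_combination double_x_formula hy0 hy hℓ hX - 4 * x * hy

lemma triple_x_formula {A B x y X Y ℓ m Z s f : K} (hy0 : y ≠ 0)
    (hs : s = 3 * x ^ 4 + 4 * A * x ^ 3 + 6 * B * x ^ 2 - B ^ 2)
    (hf : f = x ^ 3 + A * x ^ 2 + B * x) (hy : y ^ 2 = f)
    (hℓ : ℓ = (3 * x ^ 2 + 2 * A * x + B) / (2 * y)) (hX : X = ℓ ^ 2 - A - x - x)
    (hY : Y = -(ℓ * (X - x) + y)) (hs0 : s ≠ 0)
    (hm : m = (Y - y) / (X - x)) (hZ : Z = m ^ 2 - A - X - x) :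
    Z * s ^ 2 = x * s ^ 2 + 64 * f ^ 3 - 8 * f * (3 * x ^ 2 + 2 * A * x + B) * s := by
  have hd : (X - x) * (4 * y ^ 2) = -s := by rw [hs]; exact double_x_sub hy0 (hy.trans hf) hℓ hX
  have hXx : X - x = -s / (4 * y ^ 2) := by rw [← hd]; field_simp
  have hm' : m = 8 * y ^ 3 / s - ℓ := by
    rw [hm, hY, hXx]; field_simp; ring
  have hly : ℓ * (2 * y) = 3 * x ^ 2 + 2 * A * x + B := by rw [hℓ]; field_simp
  have hms : m * s = 8 * y ^ 3 - ℓ * s := by rw [hm']; field_simp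
  rw [← hly, ← hy, hZ]
  linear_combination (m * s + 8 * y ^ 3 - ℓ * s) * hms - s ^ 2 * hX

end Formulas

section Points

variable {a : ℤ}

lemma equation_iff_sq_eq {x y : ℚ} : (Ea a).toAffine.Equation x y ↔
    y ^ 2 = x ^ 3 + 2 * (a : ℚ) ^ 2 * x ^ 2 + ((a : ℚ) ^ 4 - 4) * x := by
  simp [Affine.equation_iff, Ea]

lemma negY_eq (x y : ℚ) : (Ea a).toAffine.negY x y = -y := by
  simp [Affine.negY, Ea]

lemma addX_eq (x₁ x₂ ℓ : ℚ) :
    (Ea a).toAffine.addX x₁ x₂ ℓ = ℓ ^ 2 - 2 * (a : ℚ) ^ 2 - x₁ - x₂ := by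
  simp [Affine.addX, Ea]

lemma addY_eq (x₁ x₂ y₁ ℓ : ℚ) : (Ea a).toAffine.addY x₁ x₂ y₁ ℓ =
    -(ℓ * ((Ea a).toAffine.addX x₁ x₂ ℓ - x₁) + y₁) := by
  rw [Affine.addY, negY_eq, Affine.negAddY]

lemma slope_self_eq {x y : ℚ} (hy : y ≠ 0) : (Ea a).toAffine.slope x x y y =
    (3 * x ^ 2 + 2 * (2 * (a : ℚ) ^ 2) * x + ((a : ℚ) ^ 4 - 4)) / (2 * y) := by
  have : y ≠ (Ea a).toAffine.negY x y := by rw [negY_eq]; exact fun h ↦ hy (self_eq_neg.mp h)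
  rw [Affine.slope_of_Y_ne rfl this, negY_eq, sub_neg_eq_add, ← two_mul]
  simp [Ea]

/-- The `3`-adic norm of the `x`-coordinate of a point, with value `0` at infinity. -/
noncomputable def xNorm : (Ea a).toAffine.Point → ℝ
  | .zero => 0
  | .some x _ _ => ‖(x : ℚ_[3])‖

lemma xNorm_zero : xNorm (0 : (Ea a).toAffine.Point) = 0 := rfl

lemma xNorm_some {x y : ℚ} (h : (Ea a).toAffine.Nonsingular x y) :
    xNorm (.some x y h) = ‖(x : ℚ_[3])‖ := rfl

lemma one_lt_xNorm_add_self (ha : (3 : ℤ) ∣ a) {x y : ℚ} (h : (Ea a).toAffine.Nonsingular x y)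
    (hy0 : y ≠ 0) : 1 < xNorm (Point.some x y h + Point.some x y h) := by
  obtain ⟨c, rfl⟩ := ha
  have hy := equation_iff_sq_eq.mp h.1
  rw [Point.add_self_of_Y_ne (by rw [negY_eq]; exact fun h ↦ hy0 (self_eq_neg.mp h)), xNorm_some]
  have hX := double_x_formula hy0 hy (slope_self_eq hy0) (addX_eq x x _)
  generalize (Ea (3 * c)).toAffine.addX x x _ = X at hX ⊢
  have hy' := congrArg (fun q : ℚ ↦ (q : ℚ_[3])) hy
  have hX' := congrArg (fun q : ℚ ↦ (q : ℚ_[3])) hX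
  push_cast at hy' hX'
  rcases lt_or_ge 1 ‖(x : ℚ_[3])‖ with hx | hx
  · exact one_lt_norm_double_of_one_lt_norm c hx hy' hX'
  · exact one_lt_norm_double_of_norm_le_one c hx (by exact_mod_cast hy0) hy' hX'

lemma xNorm_lt_xNorm_triple (ha : (3 : ℤ) ∣ a) {P : (Ea a).toAffine.Point} (hP : 1 < xNorm P) :
    xNorm P < xNorm (3 • P) := by
  obtain ⟨c, rfl⟩ := ha
  obtain _ | ⟨x, y, h⟩ := P
  · exact absurd (hP.trans_eq xNorm_zero) (by norm_num)
  rw [xNorm_some] at hP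
  have hy := equation_iff_sq_eq.mp h.1
  have hy0 : y ≠ 0 := by
    rintro rfl
    have hy' := congrArg (fun q : ℚ ↦ (q : ℚ_[3])) hy
    push_cast at hy'
    exact cubic_ne_zero_of_one_lt_norm c hP (by rw [← hy']; ring)
  obtain ⟨hs0, hs⟩ := norm_triple c hP rfl rfl rfl rfl
  have hs0' : 3 * x ^ 4 + 4 * (2 * ((3 * c : ℤ) : ℚ) ^ 2) * x ^ 3 +
      6 * (((3 * c : ℤ) : ℚ) ^ 4 - 4) * x ^ 2 - (((3 * c : ℤ) : ℚ) ^ 4 - 4) ^ 2 ≠ 0 := by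
    intro h0
    have h0' := congrArg (fun q : ℚ ↦ (q : ℚ_[3])) h0
    push_cast at h0'
    exact hs0 h0'
  have hd := double_x_sub hy0 hy (slope_self_eq hy0) (addX_eq x x _)
  have hne : (Ea (3 * c)).toAffine.addX x x ((Ea (3 * c)).toAffine.slope x x y y) ≠ x := by
    intro h0
    rw [h0, sub_self, zero_mul, eq_comm, neg_eq_zero] at hd
    exact hs0' hd
  rw [show (3 : ℕ) = 2 + 1 from rfl, add_nsmul, two_nsmul, one_nsmul,
    Point.add_self_of_Y_ne (by rw [negY_eq]; exact fun h ↦ hy0 (self_eq_neg.mp h)),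
    Point.add_of_X_ne hne, xNorm_some, xNorm_some]
  have hZ := triple_x_formula hy0 rfl rfl hy (slope_self_eq hy0) (addX_eq x x _)
    (addY_eq x x y _) hs0' (Affine.slope_of_X_ne (W := (Ea (3 * c)).toAffine) hne) (addX_eq _ x _)
  generalize (Ea (3 * c)).toAffine.addX _ x _ = Z at hZ ⊢
  have hZ' := congrArg (fun q : ℚ ↦ (q : ℚ_[3])) hZ
  push_cast at hZ'
  exact hs _ hZ'

lemma not_isOfFinAddOrder_of_one_lt_xNorm (ha : (3 : ℤ) ∣ a) {P : (Ea a).toAffine.Point}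
    (hP : 1 < xNorm P) : ¬ IsOfFinAddOrder P := by
  have hlt : ∀ n : ℕ, 1 < xNorm (3 ^ n • P) := by
    intro n
    induction n with
    | zero => simpa using hP
    | succ n ih =>
      rw [pow_succ, mul_nsmul]
      exact ih.trans (xNorm_lt_xNorm_triple ha ih)
  have hmono : StrictMono fun n : ℕ ↦ xNorm (3 ^ n • P) := strictMono_nat_of_lt_succ fun n ↦ by
    rw [pow_succ, mul_nsmul]
    exact xNorm_lt_xNorm_triple ha (hlt n)
  have hinj : Function.Injective fun n : ℕ ↦ 3 ^ n • P :=
    fun m n hmn ↦ hmono.injective (congrArg xNorm hmn)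
  rw [← finite_multiples]
  exact Set.infinite_of_injective_forall_mem hinj
    fun n ↦ ⟨3 ^ n, rfl⟩

lemma isOfFinAddOrder_some_iff (ha : (3 : ℤ) ∣ a) {x y : ℚ}
    (h : (Ea a).toAffine.Nonsingular x y) : IsOfFinAddOrder (Point.some x y h) ↔ y = 0 := by
  refine ⟨fun hP ↦ ?_, fun hy ↦ ?_⟩
  · by_contra hy
    refine not_isOfFinAddOrder_of_one_lt_xNorm ha (one_lt_xNorm_add_self ha h hy) ?_
    rw [← two_nsmul]
    exact hP.nsmul
  · refine isOfFinAddOrder_iff_nsmul_eq_zero.mpr ⟨2, two_pos, ?_⟩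
    rw [two_nsmul]
    exact Point.add_self_of_Y_eq (by rw [negY_eq, hy, neg_zero])

lemma sq_sub_two_ne_zero (a : ℤ) : a ^ 2 - 2 ≠ 0 := by
  intro h
  have h1 : a < 2 := by nlinarith
  have h2 : -2 < a := by nlinarith
  interval_cases a <;> simp at h

lemma nonsingular_zero_right_iff {x : ℚ} : (Ea a).toAffine.Nonsingular x 0 ↔
    x = 0 ∨ x = 2 - (a : ℚ) ^ 2 ∨ x = -2 - (a : ℚ) ^ 2 := by
  have h1 : (a : ℚ) ^ 2 - 2 ≠ 0 := by exact_mod_cast sq_sub_two_ne_zero a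
  have h2 : (a : ℚ) ^ 2 + 2 ≠ 0 := by positivity
  have hΔ : (Ea a).toAffine.Δ ≠ 0 := by
    have : (Ea a).toAffine.Δ = 2 ^ 8 * ((a : ℚ) ^ 2 - 2) ^ 2 * ((a : ℚ) ^ 2 + 2) ^ 2 := by
      simp only [Ea, WeierstrassCurve.Δ, WeierstrassCurve.b₂, WeierstrassCurve.b₄,
        WeierstrassCurve.b₆, WeierstrassCurve.b₈]
      ring
    rw [this]
    positivity
  rw [← Affine.equation_iff_nonsingular_of_Δ_ne_zero hΔ, equation_iff_sq_eq]
  have : (0 : ℚ) ^ 2 = x ^ 3 + 2 * (a : ℚ) ^ 2 * x ^ 2 + ((a : ℚ) ^ 4 - 4) * x ↔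
      x * ((x - (2 - (a : ℚ) ^ 2)) * (x - (-2 - (a : ℚ) ^ 2))) = 0 := by
    rw [zero_pow two_ne_zero, eq_comm]
    ring_nf
  rw [this, mul_eq_zero, mul_eq_zero, sub_eq_zero, sub_eq_zero]

/-- The torsion points are the point at infinity and the three points of order two. -/
noncomputable def torsionEquiv (ha : (3 : ℤ) ∣ a) :
    AddCommGroup.torsion (Ea a).toAffine.Point ≃
      Option ({0, 2 - (a : ℚ) ^ 2, -2 - (a : ℚ) ^ 2} : Finset ℚ) where
  toFun
    | ⟨.zero, _⟩ => none
    | ⟨.some x y h, hP⟩ => some ⟨x, by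
        obtain rfl := (isOfFinAddOrder_some_iff ha h).mp hP
        simpa using nonsingular_zero_right_iff.mp h⟩
  invFun
    | none => 0
    | some x => ⟨.some x.1 0 (nonsingular_zero_right_iff.mpr 
          (by simpa only [Finset.mem_insert, Finset.mem_singleton] using x.2)),
        (isOfFinAddOrder_some_iff ha _).mpr rfl⟩
  left_inv := by
    rintro ⟨_ | ⟨x, y, h⟩, hP⟩
    · rfl
    · obtain rfl := (isOfFinAddOrder_some_iff ha h).mp hP
      rfl
  right_inv := by
    rintro (_ | x) <;> rfl

lemma card_torsion (ha : (3 : ℤ) ∣ a) :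
    Nat.card (AddCommGroup.torsion (Ea a).toAffine.Point) = 4 := by
  have h1 : (a : ℚ) ^ 2 - 2 ≠ 0 := by exact_mod_cast sq_sub_two_ne_zero a
  have h2 : (a : ℚ) ^ 2 + 2 ≠ 0 := by positivity
  rw [Nat.card_congr (torsionEquiv ha), Nat.card_eq_fintype_card, Fintype.card_option,
    Fintype.card_coe, Finset.card_eq_three.mpr ⟨_, _, _, ?_, ?_, ?_, rfl⟩]
  · exact fun h ↦ h1 (by linarith)
  · exact fun h ↦ h2 (by linarith)
  · exact fun h ↦ by linarith

lemma two_nsmul_torsion (ha : (3 : ℤ) ∣ a) (P : AddCommGroup.torsion (Ea a).toAffine.Point) :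
    2 • P = 0 := by
  obtain ⟨_ | ⟨x, y, h⟩, hP⟩ := P
  · exact nsmul_zero 2
  · ext1
    rw [two_nsmul]
    refine Point.add_self_of_Y_eq ?_
    rw [negY_eq, (isOfFinAddOrder_some_iff ha h).mp hP, neg_zero]

lemma isAddKleinFour_torsion (ha : (3 : ℤ) ∣ a) :
    IsAddKleinFour (AddCommGroup.torsion (Ea a).toAffine.Point) where
  card_four := card_torsion ha
  exponent_two := by
    have : Finite (AddCommGroup.torsion (Ea a).toAffine.Point) :=
      Nat.finite_of_card_ne_zero (by rw [card_torsion ha]; norm_num)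
    have : Nontrivial (AddCommGroup.torsion (Ea a).toAffine.Point) :=
      Finite.one_lt_card_iff_nontrivial.mp (by rw [card_torsion ha]; norm_num)
    exact (Nat.prime_two.eq_one_or_self_of_dvd _
      (AddMonoid.exponent_dvd_of_forall_nsmul_eq_zero (two_nsmul_torsion ha))).resolve_left
      fun h ↦ not_subsingleton _ (AddMonoid.exp_eq_one_iff.mp h)

end Points

end Ea

/-- If `a ≡ 0 (mod 3)`, then the torsion subgroup of `E_a(ℚ)` is
isomorphic to `(ℤ/2ℤ) × (ℤ/2ℤ)`. -/
theorem torsion_Ea_of_three_dvd (a : ℤ) (ha : (3 : ℤ) ∣ a) :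
    Nonempty (AddCommGroup.torsion (Ea a).toAffine.Point ≃+ (ZMod 2 × ZMod 2)) := by
  have := Ea.isAddKleinFour_torsion ha
  exact IsAddKleinFour.nonempty_addEquiv
end

section
/- Let a be an integer and let x, y be rational numbers with y² = x⁸ + (4 − 4a⁴)x⁶ + (8a⁴ + 6)x⁴ + (4 − 4a⁴)x² + 1. Set u = −2ax/(x² + 1) and v = y/(x² + 1)². Then v² = u⁴ − a²u² + 1. -/
/-- The map `ψ₁(x, y) = (-2ax/(x² + 1), y/(x² + 1)²)` sends affine points of the
genus 3 hyperelliptic curve `C_a : y² = x⁸ + (4 - 4a⁴)x⁶ + (8a⁴ + 6)x⁴ + (4 - 4a⁴)x² + 1`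
to affine points of `H_a : v² = u⁴ - a²u² + 1`. -/
theorem psi1_maps_Ca_to_Ha (a : ℤ) (x y : ℚ)
    (h : y ^ 2 = x ^ 8 + (4 - 4 * (a : ℚ) ^ 4) * x ^ 6 + (8 * (a : ℚ) ^ 4 + 6) * x ^ 4
      + (4 - 4 * (a : ℚ) ^ 4) * x ^ 2 + 1) :
    (y / (x ^ 2 + 1) ^ 2) ^ 2 =
      (-2 * (a : ℚ) * x / (x ^ 2 + 1)) ^ 4
        - (a : ℚ) ^ 2 * (-2 * (a : ℚ) * x / (x ^ 2 + 1)) ^ 2 + 1 := by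
  have hx : x ^ 2 + 1 ≠ 0 := by positivity
  rw [div_pow, h]
  field_simp
  ring
end

section
/- Let a be an integer and let x, y be rational numbers with y² = x⁸ + (4 − 4a⁴)x⁶ + (8a⁴ + 6)x⁴ + (4 − 4a⁴)x² + 1. Set u = −a(x² − 1)/(x² + 1) and v = y/(x² + 1)². Then v² = u⁴ − a²u² + 1. -/
/-- The map `ψ₂(x, y) = (-a(x² - 1)/(x² + 1), y/(x² + 1)²)` sends affine points of the
genus 3 hyperelliptic curve `C_a : y² = x⁸ + (4 - 4a⁴)x⁶ + (8a⁴ + 6)x⁴ + (4 - 4a⁴)x² + 1`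
to affine points of `H_a : v² = u⁴ - a²u² + 1`. -/
theorem psi2_maps_Ca_to_Ha (a : ℤ) (x y : ℚ)
    (h : y ^ 2 = x ^ 8 + (4 - 4 * (a : ℚ) ^ 4) * x ^ 6 + (8 * (a : ℚ) ^ 4 + 6) * x ^ 4
      + (4 - 4 * (a : ℚ) ^ 4) * x ^ 2 + 1) :
    (y / (x ^ 2 + 1) ^ 2) ^ 2 =
      (-(a : ℚ) * (x ^ 2 - 1) / (x ^ 2 + 1)) ^ 4
        - (a : ℚ) ^ 2 * (-(a : ℚ) * (x ^ 2 - 1) / (x ^ 2 + 1)) ^ 2 + 1 := by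
  have hx : x ^ 2 + 1 ≠ 0 := by positivity
  rw [div_pow, h]
  field_simp
  ring
end

section
/- Let a be an integer and let x, y be rational numbers with y² = x⁸ + (4 − 4a⁴)x⁶ + (8a⁴ + 6)x⁴ + (4 − 4a⁴)x² + 1. Set X₁ = (−a²x⁴ + 6a²x² − 2y − a²)/(x² + 1)² and Y₁ = (4a³x⁵ − 24a³x³ + 8axy + 4a³x)/(x² + 1)³. Then Y₁² = X₁³ + 2a²X₁² + (a⁴ − 4)X₁. -/
/-- The morphism `φ₁` sends affine points of the genus 3 hyperelliptic curve
`C_a : y² = x⁸ + (4 - 4a⁴)x⁶ + (8a⁴ + 6)x⁴ + (4 - 4a⁴)x² + 1` to points of the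
elliptic curve `E_a : Y² = X³ + 2a²X² + (a⁴ - 4)X`. -/
theorem phi1_maps_Ca_to_Ea (a : ℤ) (x y : ℚ)
    (h : y ^ 2 = x ^ 8 + (4 - 4 * (a : ℚ) ^ 4) * x ^ 6 + (8 * (a : ℚ) ^ 4 + 6) * x ^ 4
      + (4 - 4 * (a : ℚ) ^ 4) * x ^ 2 + 1) :
    ((4 * (a : ℚ) ^ 3 * x ^ 5 - 24 * (a : ℚ) ^ 3 * x ^ 3 + 8 * (a : ℚ) * x * y
        + 4 * (a : ℚ) ^ 3 * x) / (x ^ 2 + 1) ^ 3) ^ 2 =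
      ((-(a : ℚ) ^ 2 * x ^ 4 + 6 * (a : ℚ) ^ 2 * x ^ 2 - 2 * y - (a : ℚ) ^ 2)
          / (x ^ 2 + 1) ^ 2) ^ 3
        + 2 * (a : ℚ) ^ 2 *
          ((-(a : ℚ) ^ 2 * x ^ 4 + 6 * (a : ℚ) ^ 2 * x ^ 2 - 2 * y - (a : ℚ) ^ 2)
            / (x ^ 2 + 1) ^ 2) ^ 2
        + ((a : ℚ) ^ 4 - 4) *
          ((-(a : ℚ) ^ 2 * x ^ 4 + 6 * (a : ℚ) ^ 2 * x ^ 2 - 2 * y - (a : ℚ) ^ 2)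
            / (x ^ 2 + 1) ^ 2) := by
  have hx : x ^ 2 + 1 ≠ 0 := by positivity
  field_simp
  linear_combination
    (-4 * (-(a : ℚ) ^ 2 * x ^ 4 + 6 * (a : ℚ) ^ 2 * x ^ 2 - 2 * y - (a : ℚ) ^ 2)) * h
end

section
/- Let a be an integer and let x, y be rational numbers with y² = x⁸ + (4 − 4a⁴)x⁶ + (8a⁴ + 6)x⁴ + (4 − 4a⁴)x² + 1. Set X₂ = (a²x⁴ − 6a²x² − 2y + a²)/(x² + 1)² and Y₂ = (−2a³x⁶ + 14a³x⁴ + 4ax²y − 14a³x² − 4ay + 2a³)/(x² + 1)³. Then Y₂² = X₂³ + 2a²X₂² + (a⁴ − 4)X₂. -/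
/-- The morphism `φ₂` sends affine points of the genus 3 hyperelliptic curve
`C_a : y² = x⁸ + (4 - 4a⁴)x⁶ + (8a⁴ + 6)x⁴ + (4 - 4a⁴)x² + 1` to points of the
elliptic curve `E_a : Y² = X³ + 2a²X² + (a⁴ - 4)X`. -/
theorem phi2_maps_Ca_to_Ea (a : ℤ) (x y : ℚ)
    (h : y ^ 2 = x ^ 8 + (4 - 4 * (a : ℚ) ^ 4) * x ^ 6 + (8 * (a : ℚ) ^ 4 + 6) * x ^ 4
      + (4 - 4 * (a : ℚ) ^ 4) * x ^ 2 + 1) :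
    ((-2 * (a : ℚ) ^ 3 * x ^ 6 + 14 * (a : ℚ) ^ 3 * x ^ 4 + 4 * (a : ℚ) * x ^ 2 * y
        - 14 * (a : ℚ) ^ 3 * x ^ 2 - 4 * (a : ℚ) * y + 2 * (a : ℚ) ^ 3)
        / (x ^ 2 + 1) ^ 3) ^ 2 =
      (((a : ℚ) ^ 2 * x ^ 4 - 6 * (a : ℚ) ^ 2 * x ^ 2 - 2 * y + (a : ℚ) ^ 2)
          / (x ^ 2 + 1) ^ 2) ^ 3
        + 2 * (a : ℚ) ^ 2 *
          (((a : ℚ) ^ 2 * x ^ 4 - 6 * (a : ℚ) ^ 2 * x ^ 2 - 2 * y + (a : ℚ) ^ 2)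
            / (x ^ 2 + 1) ^ 2) ^ 2
        + ((a : ℚ) ^ 4 - 4) *
          (((a : ℚ) ^ 2 * x ^ 4 - 6 * (a : ℚ) ^ 2 * x ^ 2 - 2 * y + (a : ℚ) ^ 2)
            / (x ^ 2 + 1) ^ 2) := by
  have hd : x ^ 2 + 1 ≠ 0 := by positivity
  field_simp
  linear_combination (-4 * ((a : ℚ) ^ 2 * x ^ 4 - 6 * (a : ℚ) ^ 2 * x ^ 2 - 2 * y
    + (a : ℚ) ^ 2)) * h
end

section
/- Let a be an integer with |a| ≥ 2, and let x, y be real numbers satisfying y² = x⁸ + (4 − 4a⁴)x⁶ + (8a⁴ + 6)x⁴ + (4 − 4a⁴)x² + 1. Then |y| ≤ x⁴ + 3a²x² + 1. -/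
/-- For an integer `a` with `|a| ≥ 2` and real numbers `x, y` on the curve
`C_a : y² = x⁸ + (4 - 4a⁴)x⁶ + (8a⁴ + 6)x⁴ + (4 - 4a⁴)x² + 1`, we have
`|y| ≤ x⁴ + 3a²x² + 1`. -/
theorem abs_y_le (a : ℤ) (ha : 2 ≤ |a|) (x y : ℝ)
    (h : y ^ 2 = x ^ 8 + (4 - 4 * (a : ℝ) ^ 4) * x ^ 6 + (8 * (a : ℝ) ^ 4 + 6) * x ^ 4
      + (4 - 4 * (a : ℝ) ^ 4) * x ^ 2 + 1) :
    |y| ≤ x ^ 4 + 3 * (a : ℝ) ^ 2 * x ^ 2 + 1 := by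
  have hA : (4 : ℝ) ≤ (a : ℝ) ^ 2 := by
    have ha' : (2 : ℝ) ≤ |(a : ℝ)| := by exact_mod_cast ha
    nlinarith [sq_abs (a : ℝ)]
  have h₁ : 0 ≤ 4 * (a : ℝ) ^ 4 + 6 * (a : ℝ) ^ 2 - 4 := by nlinarith
  have h₂ : 0 ≤ (a : ℝ) ^ 4 - 4 := by nlinarith
  have hx₂ : 0 ≤ x ^ 2 := by positivity
  have hx₄ : 0 ≤ x ^ 4 := by positivity
  have hx₆ : 0 ≤ x ^ 6 := by positivity
  refine abs_le_of_sq_le_sq ?_ (by positivity)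
  rw [h]
  linarith [mul_nonneg h₁ hx₆, mul_nonneg h₂ hx₄, mul_nonneg h₁ hx₂]
end

section
/- The set of pairs of rational numbers (x, y) satisfying y² = x⁸ + (4 − 4·237⁴)x⁶ + (8·237⁴ + 6)x⁴ + (4 − 4·237⁴)x² + 1 is exactly {(1, 4), (1, −4), (−1, 4), (−1, −4), (0, 1), (0, −1)}. -/
open WeierstrassCurve.Affine

/-- The elliptic curve `y² = x(x + b - 2)(x + b + 2)` over `ℚ`. -/
def jacCurve (b : ℤ) : WeierstrassCurve.Affine ℚ := ⟨0, 2 * b, 0, b ^ 2 - 4, 0⟩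

lemma jacCurve_equation {b : ℤ} {x y : ℚ} :
    (jacCurve b).Equation x y ↔ y ^ 2 = x * (x + b - 2) * (x + b + 2) := by
  rw [equation_iff]
  simp only [jacCurve]
  constructor <;> intro h <;> linear_combination h

lemma jacCurve_nonsingular {b : ℤ} (hb : b ^ 2 ≠ 4) {x y : ℚ}
    (h : y ^ 2 = x * (x + b - 2) * (x + b + 2)) : (jacCurve b).Nonsingular x y := by
  refine (equation_iff_nonsingular_of_Δ_ne_zero ?_).mp (jacCurve_equation.mpr h)
  have hb' : (b : ℚ) ^ 2 - 4 ≠ 0 := sub_ne_zero.mpr (by exact_mod_cast hb)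
  have : (jacCurve b).Δ = 256 * ((b : ℚ) ^ 2 - 4) ^ 2 := by
    simp only [WeierstrassCurve.Δ, WeierstrassCurve.b₂, WeierstrassCurve.b₄, WeierstrassCurve.b₆,
      WeierstrassCurve.b₈, jacCurve]
    ring
  rw [this]
  positivity

namespace jacCurve

variable {b : ℤ} {x₁ y₁ x₂ y₂ x₃ y₃ x₄ y₄ : ℚ} {h₁ : (jacCurve b).Nonsingular x₁ y₁}
  {h₂ : (jacCurve b).Nonsingular x₂ y₂} {h₃ : (jacCurve b).Nonsingular x₃ y₃}
  {h₄ : (jacCurve b).Nonsingular x₄ y₄}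

lemma eq_of_add_of_ne (hx : x₁ ≠ x₂)
    (h : Point.some x₁ y₁ h₁ + Point.some x₂ y₂ h₂ = Point.some x₃ y₃ h₃) :
    x₃ = ((y₁ - y₂) / (x₁ - x₂)) ^ 2 - 2 * b - x₁ - x₂ := by
  rw [Point.add_of_X_ne hx, Point.some.injEq, slope_of_X_ne hx] at h
  rw [← h.1, addX]
  simp [jacCurve]

lemma eq_of_add_self (h : Point.some x₁ y₁ h₁ + Point.some x₁ y₁ h₁ = Point.some x₃ y₃ h₃) :
    4 * y₁ ^ 2 * x₃ = (x₁ ^ 2 - (b ^ 2 - 4)) ^ 2 := by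
  have e₁ := jacCurve_equation.mp h₁.1
  have hy : y₁ ≠ (jacCurve b).negY x₁ y₁ := fun hy ↦ by
    rw [Point.add_self_of_Y_eq hy] at h
    exact Point.some_ne_zero _ h.symm
  rw [Point.add_self_of_Y_ne hy, Point.some.injEq, slope_of_Y_ne rfl hy] at h
  have hx := h.1
  simp only [addX, negY, jacCurve] at hx hy
  have hy0 : y₁ ≠ 0 := fun h0 ↦ hy (by rw [h0]; ring)
  rw [← hx, show y₁ - (-y₁ - 0 * x₁ - 0) = 2 * y₁ by ring]
  field_simp
  linear_combination (-32 * b - 32 * x₁) * e₁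

/-- The coordinates `x(P)`, `x(Q)`, `x(P + Q)` satisfy a symmetric relation of degree two. -/
lemma biquadratic (h : Point.some x₁ y₁ h₁ + Point.some x₂ y₂ h₂ = Point.some x₃ y₃ h₃) :
    (x₁ - x₂) ^ 2 * x₃ ^ 2 - 2 * ((x₁ + x₂) * (x₁ * x₂ + (b ^ 2 - 4)) + 4 * b * (x₁ * x₂)) * x₃ +
      (x₁ * x₂ - (b ^ 2 - 4)) ^ 2 = 0 := by
  have e₁ := jacCurve_equation.mp h₁.1
  have e₂ := jacCurve_equation.mp h₂.1
  by_cases hx : x₁ = x₂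
  · subst hx
    rcases Y_eq_of_X_eq h₁.1 h₂.1 rfl with hy | hy
    · subst hy
      have := eq_of_add_self h
      linear_combination -this + 4 * x₃ * e₁
    · rw [Point.add_of_Y_eq rfl hy] at h
      exact absurd h.symm (Point.some_ne_zero _)
  · have h3 := eq_of_add_of_ne hx h
    have hd : x₁ - x₂ ≠ 0 := sub_ne_zero.mpr hx
    have h3' : (x₁ - x₂) ^ 2 * (x₃ + 2 * b + x₁ + x₂) = (y₁ - y₂) ^ 2 := by
      rw [h3]
      field_simp
      ring
    set S := (x₁ + x₂) * (x₁ * x₂ + ((b : ℚ) ^ 2 - 4)) + 4 * b * (x₁ * x₂) with hS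
    have h4 : (x₁ - x₂) ^ 2 * x₃ = S - 2 * y₁ * y₂ := by
      rw [hS]
      linear_combination h3' + e₁ + e₂
    have h5 : (x₁ - x₂) ^ 2 * ((x₁ - x₂) ^ 2 * x₃ ^ 2 - 2 * S * x₃ +
        (x₁ * x₂ - (b ^ 2 - 4)) ^ 2) = 0 := by
      have : S ^ 2 - (x₁ - x₂) ^ 2 * (x₁ * x₂ - ((b : ℚ) ^ 2 - 4)) ^ 2 =
          4 * (x₁ * (x₁ + b - 2) * (x₁ + b + 2)) * (x₂ * (x₂ + b - 2) * (x₂ + b + 2)) := by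
        rw [hS]; ring
      rw [← e₁, ← e₂] at this
      linear_combination ((x₁ - x₂) ^ 2 * x₃ - S - 2 * y₁ * y₂) * h4 - this
    exact (mul_eq_zero.mp h5).resolve_left (pow_ne_zero 2 hd)

lemma add_sub_relations (hx : x₁ ≠ x₂)
    (h : Point.some x₁ y₁ h₁ + Point.some x₂ y₂ h₂ = Point.some x₃ y₃ h₃)
    (h' : Point.some x₁ y₁ h₁ - Point.some x₂ y₂ h₂ = Point.some x₄ y₄ h₄) :
    (x₁ - x₂) ^ 2 * (x₃ + x₄) =
        2 * ((x₁ + x₂) * (x₁ * x₂ + (b ^ 2 - 4)) + 4 * b * (x₁ * x₂)) ∧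
      (x₁ - x₂) ^ 2 * (x₃ * x₄) = (x₁ * x₂ - (b ^ 2 - 4)) ^ 2 := by
  have e₁ := jacCurve_equation.mp h₁.1
  have e₂ := jacCurve_equation.mp h₂.1
  have hd : x₁ - x₂ ≠ 0 := sub_ne_zero.mpr hx
  have h3 := eq_of_add_of_ne hx h
  rw [sub_eq_add_neg, Point.neg_some] at h'
  have h4 := eq_of_add_of_ne hx h'
  have hn : (jacCurve b).negY x₂ y₂ = -y₂ := by simp [negY, jacCurve]
  rw [hn] at h4
  set S := (x₁ + x₂) * (x₁ * x₂ + ((b : ℚ) ^ 2 - 4)) + 4 * b * (x₁ * x₂) with hS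
  have h3' : (x₁ - x₂) ^ 2 * x₃ = S - 2 * y₁ * y₂ := by
    have : (x₁ - x₂) ^ 2 * (x₃ + 2 * b + x₁ + x₂) = (y₁ - y₂) ^ 2 := by
      rw [h3]
      field_simp
      ring
    linear_combination this + e₁ + e₂
  have h4' : (x₁ - x₂) ^ 2 * x₄ = S + 2 * y₁ * y₂ := by
    have : (x₁ - x₂) ^ 2 * (x₄ + 2 * b + x₁ + x₂) = (y₁ + y₂) ^ 2 := by
      rw [h4]
      field_simp
      ring
    linear_combination this + e₁ + e₂
  refine ⟨by linear_combination h3' + h4', mul_left_cancel₀ (pow_ne_zero 2 hd) ?_⟩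
  have : S ^ 2 - (x₁ - x₂) ^ 2 * (x₁ * x₂ - ((b : ℚ) ^ 2 - 4)) ^ 2 =
      4 * (x₁ * (x₁ + b - 2) * (x₁ + b + 2)) * (x₂ * (x₂ + b - 2) * (x₂ + b + 2)) := by
    rw [hS]; ring
  rw [← e₁, ← e₂] at this
  linear_combination (x₁ - x₂) ^ 2 * x₄ * h3' + (S - 2 * y₁ * y₂) * h4' + this

/-- The 2-descent maps are multiplicative up to squares. -/
lemma exists_sq_eq_of_add {e : ℚ} (he : e * (e + b - 2) * (e + b + 2) = 0) (hx : x₁ ≠ x₂)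
    (h : Point.some x₁ y₁ h₁ + Point.some x₂ y₂ h₂ = Point.some x₃ y₃ h₃) :
    ∃ s, (x₁ - e) * (x₂ - e) * (x₃ - e) = s ^ 2 := by
  have e₁ := jacCurve_equation.mp h₁.1
  have e₂ := jacCurve_equation.mp h₂.1
  have hd : x₁ - x₂ ≠ 0 := sub_ne_zero.mpr hx
  have h3 := eq_of_add_of_ne hx h
  refine ⟨(y₁ * (x₂ - e) - y₂ * (x₁ - e)) / (x₁ - x₂), ?_⟩
  rw [h3]
  field_simp
  linear_combination (x₂ - e) * (x₁ - x₂) * e₁ - (x₁ - e) * (x₁ - x₂) * e₂ - (x₁ - x₂) ^ 2 * he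

private lemma exists_add_self_eq_aux (hb : b ^ 2 ≠ 4) {x y r s t : ℚ}
    {h : (jacCurve b).Nonsingular x y} (hr : x = r ^ 2) (hs : x + b - 2 = s ^ 2)
    (ht : x + b + 2 = t ^ 2) (hy : y = r * s * t) : ∃ R, Point.some x y h = R + R := by
  have hb₁ : (b : ℚ) - 2 ≠ 0 := fun h0 ↦ hb (by
    have : b = 2 := by exact_mod_cast sub_eq_zero.mp h0
    rw [this]; norm_num)
  have hb₂ : (b : ℚ) + 2 ≠ 0 := fun h0 ↦ hb (by
    have : b = -2 := by exact_mod_cast eq_neg_of_add_eq_zero_left h0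
    rw [this]; norm_num)
  have hrs : r + s ≠ 0 := fun h0 ↦ hb₁ (by linear_combination hs - hr - (r - s) * h0)
  have hrt : r + t ≠ 0 := fun h0 ↦ hb₂ (by linear_combination ht - hr - (r - t) * h0)
  have hst : s + t ≠ 0 := fun h0 ↦ four_ne_zero (α := ℚ) (by
    linear_combination ht - hs - (s - t) * h0)
  have hb' : (b : ℚ) = s ^ 2 - r ^ 2 + 2 := by linear_combination hs - hr
  have ht' : t ^ 2 = s ^ 2 + 4 := by linear_combination hs - ht
  have hR : (jacCurve b).Nonsingular ((r + s) * (r + t)) ((r + s) * (r + t) * (s + t)) := by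
    refine jacCurve_nonsingular hb ?_
    have h₁ : (r + s) * (r + t) + b - 2 = (r + s) * (s + t) := by linear_combination hs - hr
    have h₂ : (r + s) * (r + t) + b + 2 = (r + t) * (s + t) := by linear_combination ht - hr
    rw [h₁, h₂]
    ring
  have hne : (r + s) * (r + t) * (s + t) ≠ 0 := mul_ne_zero (mul_ne_zero hrs hrt) hst
  have hneg : (jacCurve b).negY ((r + s) * (r + t)) ((r + s) * (r + t) * (s + t)) =
      -((r + s) * (r + t) * (s + t)) := by simp [negY, jacCurve]
  have hY : (r + s) * (r + t) * (s + t) ≠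
      (jacCurve b).negY ((r + s) * (r + t)) ((r + s) * (r + t) * (s + t)) := by
    rw [hneg]
    exact fun h0 ↦ hne (by linear_combination h0 / 2)
  have hslope : (jacCurve b).slope ((r + s) * (r + t)) ((r + s) * (r + t))
      ((r + s) * (r + t) * (s + t)) ((r + s) * (r + t) * (s + t)) = r + s + t := by
    rw [slope_of_Y_ne rfl hY, hneg, div_eq_iff (by rw [sub_neg_eq_add, ← two_mul]; positivity)]
    simp only [jacCurve]
    rw [hb']
    linear_combination (-(r ^ 2 + 2 * (r * s + r * t + s * t) + s ^ 2)) * ht'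
  refine ⟨Point.some _ _ hR, ?_⟩
  rw [Point.add_self_of_Y_ne hY, Point.some.injEq, hslope]
  have hX : (jacCurve b).addX ((r + s) * (r + t)) ((r + s) * (r + t)) (r + s + t) = r ^ 2 := by
    simp only [addX, jacCurve]
    linear_combination -hs - ht + 2 * hr
  refine ⟨by rw [hX, hr], ?_⟩
  rw [addY, negAddY, hX, hy]
  simp only [negY, jacCurve]
  ring

lemma exists_add_self_eq (hb : b ^ 2 ≠ 4) {x y : ℚ} (h : (jacCurve b).Nonsingular x y)
    (hr : IsSquare x) (hs : IsSquare (x + b - 2)) (ht : IsSquare (x + b + 2)) :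
    ∃ R, Point.some x y h = R + R := by
  obtain ⟨⟨r, hr⟩, ⟨s, hs⟩, t, ht⟩ := And.intro hr (And.intro hs ht)
  rw [← sq] at hr hs ht
  have hy : y ^ 2 = (r * s * t) ^ 2 := by
    rw [jacCurve_equation.mp h.1, hs, ht, hr]
    ring
  rcases sq_eq_sq_iff_eq_or_eq_neg.mp hy with hy | hy
  · exact exists_add_self_eq_aux hb hr hs ht hy
  · exact exists_add_self_eq_aux (r := -r) hb (by rw [hr]; ring) hs ht (by rw [hy]; ring)

end jacCurve

namespace jacCurve
variable {b : ℤ}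

section Reduction

variable {k : Type*} [Field k] {A : Subring ℚ} {φ : A →+* k}

/-- The points of the curve whose `x`-coordinate is infinite or lies outside of `A`. -/
def IsInfiniteMod (A : Subring ℚ) : (jacCurve b).Point → Prop
  | .zero => True
  | .some x _ _ => x ∉ A

lemma isInfiniteMod_neg {P : (jacCurve b).Point} (h : IsInfiniteMod A P) :
    IsInfiniteMod A (-P) := by
  cases P with
  | zero => exact h
  | some x y hxy => exact h

lemma isInfiniteMod_add (hφ : ∀ x ∉ A, ∃ h : x⁻¹ ∈ A, φ ⟨x⁻¹, h⟩ = 0) {P Q : (jacCurve b).Point}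
    (hP : IsInfiniteMod A P) (hQ : IsInfiniteMod A Q) : IsInfiniteMod A (P + Q) := by
  rcases P with _ | ⟨x₁, y₁, h₁⟩
  · rwa [← Point.zero_def, zero_add]
  rcases Q with _ | ⟨x₂, y₂, h₂⟩
  · rwa [← Point.zero_def, add_zero]
  generalize hR : Point.some x₁ y₁ h₁ + Point.some x₂ y₂ h₂ = R
  rcases R with _ | ⟨x₃, y₃, h₃⟩
  · trivial
  intro hx₃
  obtain ⟨m₁, e₁⟩ := hφ x₁ hP
  obtain ⟨m₂, e₂⟩ := hφ x₂ hQ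
  have n₁ : x₁ ≠ 0 := fun h ↦ hP (h ▸ A.zero_mem)
  have n₂ : x₂ ≠ 0 := fun h ↦ hQ (h ▸ A.zero_mem)
  have key := biquadratic hR
  set t₁ : A := ⟨x₁⁻¹, m₁⟩
  set t₂ : A := ⟨x₂⁻¹, m₂⟩
  have : (t₁ - t₂) ^ 2 * (⟨x₃, hx₃⟩ : A) ^ 2 -
      2 * ((t₁ + t₂) * (1 + ((b : A) ^ 2 - 4) * (t₁ * t₂)) + 4 * b * (t₁ * t₂)) * (⟨x₃, hx₃⟩ : A) +
      (1 - ((b : A) ^ 2 - 4) * (t₁ * t₂)) ^ 2 = 0 := by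
    refine Subtype.ext ?_
    push_cast
    simp only [t₁, t₂, show ((2 : A) : ℚ) = 2 from rfl, show ((4 : A) : ℚ) = 4 from rfl]
    field_simp
    linear_combination key
  simpa [e₁, e₂] using congrArg φ this

/-- The kernel of the reduction map attached to `φ`. -/
def redKernel (hφ : ∀ x ∉ A, ∃ h : x⁻¹ ∈ A, φ ⟨x⁻¹, h⟩ = 0) : AddSubgroup (jacCurve b).Point where
  carrier := {P | IsInfiniteMod A P}
  zero_mem' := trivial
  add_mem' := isInfiniteMod_add hφ
  neg_mem' := isInfiniteMod_neg

lemma not_isInfiniteMod_add (hφ : ∀ x ∉ A, ∃ h : x⁻¹ ∈ A, φ ⟨x⁻¹, h⟩ = 0) {x₁ y₁ x₂ y₂ : ℚ}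
    {h₁ : (jacCurve b).Nonsingular x₁ y₁} {h₂ : (jacCurve b).Nonsingular x₂ y₂} (hx₁ : x₁ ∈ A)
    (hx₂ : x₂ ∈ A) (hne : φ ⟨x₁, hx₁⟩ ≠ φ ⟨x₂, hx₂⟩) :
    ¬ IsInfiniteMod A (Point.some x₁ y₁ h₁ + Point.some x₂ y₂ h₂) := by
  have hx : x₁ ≠ x₂ := fun h ↦ hne (by simp only [h])
  generalize hR : Point.some x₁ y₁ h₁ + Point.some x₂ y₂ h₂ = R
  rcases R with _ | ⟨x₃, y₃, h₃⟩
  · rw [Point.add_of_X_ne hx] at hR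
    exact absurd hR (Point.some_ne_zero _)
  intro hx₃
  obtain ⟨m₃, e₃⟩ := hφ x₃ hx₃
  have n₃ : x₃ ≠ 0 := fun h ↦ hx₃ (h ▸ A.zero_mem)
  have key := biquadratic hR
  set a₁ : A := ⟨x₁, hx₁⟩
  set a₂ : A := ⟨x₂, hx₂⟩
  set t₃ : A := ⟨x₃⁻¹, m₃⟩
  have : (a₁ - a₂) ^ 2 -
      2 * ((a₁ + a₂) * (a₁ * a₂ + ((b : A) ^ 2 - 4)) + 4 * b * (a₁ * a₂)) * t₃ +
      (a₁ * a₂ - ((b : A) ^ 2 - 4)) ^ 2 * t₃ ^ 2 = 0 := by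
    refine Subtype.ext ?_
    push_cast
    simp only [a₁, a₂, t₃, show ((2 : A) : ℚ) = 2 from rfl, show ((4 : A) : ℚ) = 4 from rfl]
    field_simp
    linear_combination key
  have := congrArg φ this
  simp only [map_add, map_sub, map_mul, map_pow, e₃, map_zero] at this
  exact sub_ne_zero.mpr hne (by simpa using this)

lemma isInfiniteMod_add_self (hk : φ (4 * ((b : A) ^ 2 - 4)) ≠ 0) {x y : ℚ}
    {h : (jacCurve b).Nonsingular x y} (hx : x ∈ A)
    (h0 : φ ((⟨x, hx⟩ + b - 2) * (⟨x, hx⟩ + b + 2)) = 0) :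
    IsInfiniteMod A (Point.some x y h + Point.some x y h) := by
  generalize hR : Point.some x y h + Point.some x y h = R
  rcases R with _ | ⟨x₃, y₃, h₃⟩
  · trivial
  intro hx₃
  have key := biquadratic hR
  set a : A := ⟨x, hx⟩
  have e : 4 * (a * ((a + b - 2) * (a + b + 2))) * (⟨x₃, hx₃⟩ : A) =
      (a ^ 2 - ((b : A) ^ 2 - 4)) ^ 2 := by
    refine Subtype.ext ?_
    push_cast
    simp only [a, show ((2 : A) : ℚ) = 2 from rfl, show ((4 : A) : ℚ) = 4 from rfl]
    linear_combination -key
  have e := congrArg φ e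
  rw [map_mul φ (4 * _), map_mul φ 4, map_mul φ a, h0, map_pow] at e
  have e0 : φ (a ^ 2 - ((b : A) ^ 2 - 4)) = 0 := by
    simpa using e.symm
  simp only [map_mul, map_sub, map_add, map_pow, map_intCast, map_ofNat] at e0 h0 hk
  apply hk
  rcases mul_eq_zero.mp h0 with h0 | h0
  · linear_combination (-(b + 2)) * e0 + (b + 2) * (φ a - b + 2) * h0
  · linear_combination (b - 2) * e0 - (b - 2) * (φ a - b - 2) * h0

lemma isInfiniteMod_add_or_sub (hk : φ (4 * ((b : A) ^ 2 - 4)) ≠ 0) {x₁ y₁ x₂ y₂ : ℚ}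
    {h₁ : (jacCurve b).Nonsingular x₁ y₁} {h₂ : (jacCurve b).Nonsingular x₂ y₂} (hx₁ : x₁ ∈ A)
    (hx₂ : x₂ ∈ A) (heq : φ ⟨x₁, hx₁⟩ = φ ⟨x₂, hx₂⟩) :
    IsInfiniteMod A (Point.some x₁ y₁ h₁ - Point.some x₂ y₂ h₂) ∨
      IsInfiniteMod A (Point.some x₁ y₁ h₁ + Point.some x₂ y₂ h₂) := by
  by_cases hx : x₁ = x₂
  · rcases Point.X_eq_iff.mp hx with h | h
    · left
      rw [h, sub_self]
      trivial
    · right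
      rw [h, neg_add_cancel]
      trivial
  generalize hR : Point.some x₁ y₁ h₁ + Point.some x₂ y₂ h₂ = R
  generalize hS : Point.some x₁ y₁ h₁ - Point.some x₂ y₂ h₂ = S
  rcases R with _ | ⟨x₃, y₃, h₃⟩
  · right
    trivial
  rcases S with _ | ⟨x₄, y₄, h₄⟩
  · left
    trivial
  obtain ⟨e₁, e₂⟩ := add_sub_relations hx hR hS
  by_contra! hcon
  have hx₃ : x₃ ∈ A := not_not.mp hcon.2
  have hx₄ : x₄ ∈ A := not_not.mp hcon.1
  set a₁ : A := ⟨x₁, hx₁⟩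
  set a₂ : A := ⟨x₂, hx₂⟩
  have e₁ : (a₁ - a₂) ^ 2 * (⟨x₃, hx₃⟩ + ⟨x₄, hx₄⟩) =
      2 * ((a₁ + a₂) * (a₁ * a₂ + ((b : A) ^ 2 - 4)) + 4 * b * (a₁ * a₂)) := by
    refine Subtype.ext ?_
    push_cast
    exact e₁
  have e₂ : (a₁ - a₂) ^ 2 * (⟨x₃, hx₃⟩ * ⟨x₄, hx₄⟩) = (a₁ * a₂ - ((b : A) ^ 2 - 4)) ^ 2 := by
    refine Subtype.ext ?_
    push_cast
    exact e₂
  have e₁ := congrArg φ e₁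
  have e₂ := congrArg φ e₂
  simp only [map_mul, map_sub, map_add, map_pow, map_intCast, map_ofNat, heq, sub_self] at e₁ e₂ hk
  have e₃ : φ a₂ * φ a₂ - ((b : k) ^ 2 - 4) = 0 := by simpa using e₂.symm
  set x := φ a₂
  have h4 : (4 : k) ≠ 0 := left_ne_zero_of_mul hk
  have hC : (b : k) ^ 2 - 4 ≠ 0 := right_ne_zero_of_mul hk
  have e₄ : 8 * ((b : k) ^ 2 - 4) * (x + b) = 0 := by
    linear_combination -e₁ - (4 * x + 8 * b) * e₃
  have h8 : (8 : k) ≠ 0 := fun h ↦ h4 (by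
    have : (4 : k) * 4 = 0 := by linear_combination 2 * h
    simpa using this)
  have e₅ : x + b = 0 := (mul_eq_zero.mp e₄).resolve_left (mul_ne_zero h8 hC)
  exact h4 (by linear_combination e₃ - (x - b) * e₅)

lemma finite_quotient_redKernel [Finite k] (hφ : ∀ x ∉ A, ∃ h : x⁻¹ ∈ A, φ ⟨x⁻¹, h⟩ = 0)
    (hk : φ (4 * ((b : A) ^ 2 - 4)) ≠ 0) :
    Finite ((jacCurve b).Point ⧸ redKernel (b := b) hφ) := by
  classical
  let f : (jacCurve b).Point → Option k
    | .zero => none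
    | .some x _ _ => if h : x ∈ A then some (φ ⟨x, h⟩) else none
  have hf (P Q : (jacCurve b).Point) (h : f P = f Q) :
      P - Q ∈ redKernel hφ ∨ P + Q ∈ redKernel hφ := by
    have hnone (P : (jacCurve b).Point) (h : f P = none) : P ∈ redKernel hφ := by
      rcases P with _ | ⟨x, y, hP⟩
      · trivial
      · intro hx
        simp [f, hx] at h
    cases hP : f P with
    | none => exact .inl ((redKernel hφ).sub_mem (hnone P hP) (hnone Q (h ▸ hP)))
    | some a =>
      rcases P with _ | ⟨x₁, y₁, h₁⟩
      · simp [f] at hP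
      rcases Q with _ | ⟨x₂, y₂, h₂⟩
      · rw [h] at hP
        simp [f] at hP
      rw [h] at hP
      by_cases hx₂ : x₂ ∈ A
      · by_cases hx₁ : x₁ ∈ A
        · simp only [f, hx₁, hx₂, dif_pos, Option.some.injEq] at h
          exact isInfiniteMod_add_or_sub hk hx₁ hx₂ h
        · simp [f, hx₁, hx₂] at h
      · simp [f, hx₂] at hP
  rw [← Set.finite_univ_iff]
  refine Set.Finite.of_finite_fibers (fun q ↦ f q.out) (Set.toFinite _) fun a _ ↦ ?_
  obtain he | ⟨q₀, hq₀⟩ := Set.eq_empty_or_nonempty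
    (Set.univ ∩ (fun q : (jacCurve b).Point ⧸ redKernel (b := b) hφ ↦ f q.out) ⁻¹' {a})
  · rw [he]
    exact Set.finite_empty
  refine (Set.toFinite {q₀, -q₀}).subset fun q hq ↦ ?_
  have := hf q.out q₀.out (hq.2.trans hq₀.2.symm)
  rw [← QuotientAddGroup.eq_zero_iff, ← QuotientAddGroup.eq_zero_iff, QuotientAddGroup.mk_sub,
    QuotientAddGroup.mk_add, QuotientAddGroup.out_eq', QuotientAddGroup.out_eq', sub_eq_zero,
    add_eq_zero_iff_eq_neg] at this
  exact this

end Reduction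
end jacCurve

/-- If `2d ∈ 4H` and `2H` is generated by `2d` together with `4H`, then the finite abelian group `H`
has no element of order four. -/
lemma add_self_eq_zero_of_four {H : Type*} [AddCommGroup H] [Finite H] {d : H}
    (hd : ∃ r, d + d = r + r + (r + r))
    (hH : ∀ h : H, ∃ (n : ℤ) (h' : H), h + h = n • (d + d) + (h' + h' + (h' + h'))) {r : H}
    (hr : r + r + (r + r) = 0) : r + r = 0 := by
  let D : H →+ H := AddMonoidHom.id H + AddMonoidHom.id H
  have hD (x : H) : D x = x + x := rfl
  let g : D.range → D.range := fun x ↦ ⟨D x, x, rfl⟩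
  have hg : Function.Surjective g := by
    rintro ⟨_, x, rfl⟩
    obtain ⟨s, hs⟩ := hd
    obtain ⟨n, y, hy⟩ := hH x
    refine ⟨⟨D (n • s + y), _, rfl⟩, Subtype.ext ?_⟩
    simp only [g, hD, hy, hs, smul_add]
    abel
  have := Finite.injective_iff_surjective.mpr hg
  have h0 := @this ⟨D r, r, rfl⟩ 0 (Subtype.ext (by simpa [g, hD] using hr))
  exact congrArg Subtype.val h0

section Descent

lemma Int.isSquare_of_mul_sq {a b c : ℤ} (hb : b ≠ 0) (h : a * b ^ 2 = c ^ 2) : IsSquare a := by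
  obtain ⟨e, rfl⟩ := (Int.pow_dvd_pow_iff two_ne_zero).mp (Dvd.intro_left a h)
  exact ⟨e, mul_right_cancel₀ (pow_ne_zero 2 hb) (by linear_combination h)⟩

/-- An integer whose valuations away from a prime `t` are all even. -/
lemma Int.isSquare_of_even_padicValInt {t : ℕ} (ht : t.Prime) {u : ℤ} (hu : u ≠ 0)
    (h : ∀ l : ℕ, l.Prime → l ≠ t → Even (padicValInt l u)) :
    IsSquare u ∨ IsSquare (-u) ∨ IsSquare (t * u) ∨ IsSquare (-(t * u)) := by
  obtain ⟨a, r, hr, ha⟩ := Nat.sq_mul_squarefree u.natAbs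
  have hra : r ^ 2 * a ≠ 0 := hr ▸ Int.natAbs_ne_zero.mpr hu
  have ha0 : a ≠ 0 := right_ne_zero_of_mul hra
  have hr0 : r ≠ 0 := fun h0 ↦ hra (by simp [h0])
  have hpow := Nat.eq_prime_pow_of_unique_prime_dvd ha0 (p := t) fun {l} hl hla ↦ by
    by_contra hlt
    have : Fact l.Prime := ⟨hl⟩
    have h1 := h l hl hlt
    rw [padicValInt, ← hr, padicValNat.mul (pow_ne_zero 2 hr0) ha0, padicValNat.pow] at h1
    have h2 : padicValNat l a ≤ 1 := by
      rw [← Nat.factorization_def _ hl]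
      exact ha.natFactorization_le_one l
    have h3 := one_le_padicValNat_of_dvd ha0 hla
    obtain ⟨j, hj⟩ := h1
    omega
  have hcase : a = 1 ∨ a = t := by
    generalize a.primeFactorsList.length = j at hpow
    rcases j with _ | _ | j
    · exact .inl (by simpa using hpow)
    · exact .inr (by simpa using hpow)
    · exact absurd (ha t ⟨t ^ j, by rw [hpow]; ring⟩) ht.not_isUnit
  have hu' : u = r ^ 2 * a ∨ u = -(r ^ 2 * a) := by
    rcases Int.natAbs_eq u with h | h <;> rw [← hr] at h <;> push_cast at h
    · exact .inl h
    · exact .inr h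
  rcases hcase with rfl | rfl <;> rcases hu' with hu' | hu' <;> rw [hu']
  · exact .inl ⟨r, by push_cast; ring⟩
  · exact .inr (.inl ⟨r, by push_cast; ring⟩)
  · exact .inr (.inr (.inl ⟨a * r, by ring⟩))
  · exact .inr (.inr (.inr ⟨a * r, by ring⟩))

private lemma even_padicValInt_of_mul {l : ℕ} (hl : l.Prime) {a b c : ℤ} (hc : c ≠ 0)
    (h : a * b = c ^ 2) (hb : ¬ (l : ℤ) ∣ b) : Even (padicValInt l a) := by
  have : Fact l.Prime := ⟨hl⟩
  have hab : a * b ≠ 0 := h ▸ pow_ne_zero 2 hc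
  have h1 := congrArg (padicValInt l) h
  rw [padicValInt.mul (left_ne_zero_of_mul hab) (right_ne_zero_of_mul hab), sq,
    padicValInt.mul hc hc, padicValInt.eq_zero_of_not_dvd hb] at h1
  exact ⟨_, h1⟩

private lemma descent_mod_four {p q : ℕ} (hpq : p = q + 4) (hq4 : q % 4 = 3) {m d α β s t e : ℤ}
    (hmd : IsCoprime m d) (hu : α * (m + p * d ^ 2) = s ^ 2) (hv : β * (m + q * d ^ 2) = t ^ 2)
    (he : α * β * m = e ^ 2) : ¬ ((α : ZMod 4) = 1 ∧ (β : ZMod 4) = 3 ∨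
      (α : ZMod 4) = 3 ∧ (β : ZMod 4) = 1) := by
  have hq : (q : ZMod 4) = 3 := by
    rw [← Nat.div_add_mod q 4, hq4]
    push_cast
    rw [show (4 : ZMod 4) = 0 from rfl]
    ring
  have hp : (p : ZMod 4) = 3 := by
    rw [hpq]
    push_cast
    rw [hq]
    rfl
  obtain ⟨x, y, hxy⟩ := hmd
  have hu := congrArg (Int.cast (R := ZMod 4)) hu
  have hv := congrArg (Int.cast (R := ZMod 4)) hv
  have he := congrArg (Int.cast (R := ZMod 4)) he
  have hxy := congrArg (Int.cast (R := ZMod 4)) hxy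
  push_cast at hu hv he hxy
  rw [hp] at hu
  rw [hq] at hv
  have h2 : ¬ (2 * (m : ZMod 4) = 0 ∧ 2 * (d : ZMod 4) = 0) := by
    rintro ⟨h1, h2⟩
    have : (2 : ZMod 4) = 0 := by linear_combination (-2) * hxy + x * h1 + y * h2
    exact absurd this (by decide)
  clear hxy
  generalize (m : ZMod 4) = m, (d : ZMod 4) = d, (s : ZMod 4) = s, (t : ZMod 4) = t,
    (e : ZMod 4) = e at *
  rintro (⟨h1, h3⟩ | ⟨h1, h3⟩) <;> rw [h1, h3] at he <;> rw [h1] at hu <;> rw [h3] at hv <;>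
  · clear h1 h3
    revert m d s t e
    decide +revert

lemma descent_int {p q : ℕ} (hp : p.Prime) (hq : q.Prime) (hpq : p = q + 4) (hq4 : q % 4 = 3)
    {m d c : ℤ} (hmd : IsCoprime m d) (hc : c ≠ 0)
    (h : m * (m + q * d ^ 2) * (m + p * d ^ 2) = c ^ 2)
    (h2 : Even (padicValInt 2 (m + p * d ^ 2))) :
    IsSquare (m + p * d ^ 2) ∧ IsSquare (m + q * d ^ 2) ∨
    IsSquare (p * (m + p * d ^ 2)) ∧ IsSquare (q * (m + q * d ^ 2)) ∨
    IsSquare (m + p * d ^ 2) ∧ IsSquare (-(q * (m + q * d ^ 2))) ∨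
    IsSquare (p * (m + p * d ^ 2)) ∧ IsSquare (-(m + q * d ^ 2)) := by
  set u := m + p * d ^ 2 with hu
  set v := m + q * d ^ 2 with hv
  have huv : u = v + 4 * d ^ 2 := by rw [hu, hv, hpq]; push_cast; ring
  have hne : m * v * u ≠ 0 := h ▸ pow_ne_zero 2 hc
  have hu0 : u ≠ 0 := right_ne_zero_of_mul hne
  have hv0 : v ≠ 0 := right_ne_zero_of_mul (left_ne_zero_of_mul hne)
  have hm0 : m ≠ 0 := left_ne_zero_of_mul (left_ne_zero_of_mul hne)
  have hcop {l : ℕ} (hl : l.Prime) (hm : (l : ℤ) ∣ m) (hd : (l : ℤ) ∣ d) : False :=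
    hl.ne_one (by simpa using Int.isUnit_iff_natAbs_eq.mp (hmd.isUnit_of_dvd' hm hd))
  have hdvd {l r : ℕ} (hl : l.Prime) (hr : r.Prime) (hm : (l : ℤ) ∣ m)
      (hw : (l : ℤ) ∣ m + r * d ^ 2) : l = r := by
    have h1 : (l : ℤ) ∣ r * d ^ 2 := (dvd_add_right hm).mp hw
    rcases (Nat.prime_iff_prime_int.mp hl).dvd_or_dvd h1 with h1 | h1
    · exact (Nat.prime_dvd_prime_iff_eq hl hr).mp (Int.natCast_dvd_natCast.mp h1)
    · exact (hcop hl hm ((Nat.prime_iff_prime_int.mp hl).dvd_of_dvd_pow h1)).elim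
  have hdvd2 {l : ℕ} (hl : l.Prime) (hlu : (l : ℤ) ∣ u) (hlv : (l : ℤ) ∣ v) : l = 2 := by
    rw [huv] at hlu
    have h1 : (l : ℤ) ∣ 2 ^ 2 * d ^ 2 := (dvd_add_right hlv).mp hlu
    have hl' := Nat.prime_iff_prime_int.mp hl
    rcases hl'.dvd_or_dvd h1 with h1 | h1
    · exact (Nat.prime_dvd_prime_iff_eq hl Nat.prime_two).mp
        (Int.natCast_dvd_natCast.mp (hl'.dvd_of_dvd_pow h1))
    · have hd := hl'.dvd_of_dvd_pow h1
      have : (l : ℤ) ∣ m := (dvd_add_left (hd.mul_left (q * d))).mp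
        (by rwa [hv, sq, ← mul_assoc] at hlv)
      exact (hcop hl this hd).elim
  have hU := Int.isSquare_of_even_padicValInt hp hu0 fun l hl hlp ↦ by
    by_cases hl2 : l = 2
    · rwa [hl2]
    by_cases hlu : (l : ℤ) ∣ u
    · refine even_padicValInt_of_mul hl hc (b := m * v) (by linear_combination h) fun hmv ↦ ?_
      rcases (Nat.prime_iff_prime_int.mp hl).dvd_or_dvd hmv with hm | hv
      · exact hlp (hdvd hl hp hm hlu)
      · exact hl2 (hdvd2 hl hlu hv)
    · rw [padicValInt.eq_zero_of_not_dvd hlu]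
      exact Even.zero
  have hV := Int.isSquare_of_even_padicValInt hq hv0 fun l hl hlq ↦ by
    by_cases hlv : (l : ℤ) ∣ v
    · have hlm : ¬ (l : ℤ) ∣ m := fun hm ↦ hlq (hdvd hl hq hm hlv)
      by_cases hl2 : l = 2
      · subst hl2
        have h3 := even_padicValInt_of_mul hl hc (a := v * u) (by linear_combination h) hlm
        rw [padicValInt.mul hv0 hu0, Nat.even_add] at h3
        exact h3.mpr h2
      · refine even_padicValInt_of_mul hl hc (b := m * u) (by linear_combination h) fun hmu ↦ ?_
        rcases (Nat.prime_iff_prime_int.mp hl).dvd_or_dvd hmu with hm | hu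
        · exact hlm hm
        · exact hl2 (hdvd2 hl hu hlv)
    · rw [padicValInt.eq_zero_of_not_dvd hlv]
      exact Even.zero
  have hpos : 0 < u := by
    by_contra! hle
    have hd2 := sq_nonneg d
    have hvm : v = m + q * d ^ 2 := hv
    have hqd : 0 ≤ (q : ℤ) * d ^ 2 := by positivity
    have hu1 : u < 0 := lt_of_le_of_ne hle hu0
    have hv1 : v < 0 := by linarith
    have hm1 : m < 0 := by linarith
    have := mul_neg_of_pos_of_neg (mul_pos_of_neg_of_neg hm1 hv1) hu1
    rw [h] at this
    exact absurd this (not_lt.mpr (sq_nonneg c))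
  have hU' : IsSquare u ∨ IsSquare (p * u) := by
    rcases hU with h | h | h | h
    · exact .inl h
    · linarith [h.nonneg]
    · exact .inr h
    · have : 0 < p * u := mul_pos (by exact_mod_cast hp.pos) hpos
      linarith [h.nonneg]
  have hbad {α β : ℤ} (hα : α ≠ 0) (hβ : β ≠ 0) (hs : IsSquare (α * u)) (ht : IsSquare (β * v))
      (hαβ : (α : ZMod 4) = 1 ∧ (β : ZMod 4) = 3 ∨ (α : ZMod 4) = 3 ∧ (β : ZMod 4) = 1) :
      False := by
    obtain ⟨s, hs⟩ := hs
    obtain ⟨t, ht⟩ := ht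
    have hst : s * t ≠ 0 := by
      rintro h0
      have : (α * u) * (β * v) = 0 := by rw [hs, ht]; linear_combination (s * t) * h0
      simp [hα, hβ, hu0, hv0] at this
    obtain ⟨e, he⟩ := Int.isSquare_of_mul_sq (a := α * β * m) (c := α * β * c) hst (by
      rw [show (s * t) ^ 2 = (s * s) * (t * t) by ring, ← hs, ← ht]
      linear_combination (α * β) ^ 2 * h)
    exact descent_mod_four hpq hq4 hmd (hs.trans (sq s).symm) (ht.trans (sq t).symm)
      (he.trans (sq e).symm) hαβ
  have hq' : (q : ZMod 4) = 3 := by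
    rw [← Nat.div_add_mod q 4, hq4]
    push_cast
    rw [show (4 : ZMod 4) = 0 from rfl]
    ring
  have hp' : (p : ZMod 4) = 3 := by
    rw [hpq]
    push_cast
    rw [hq']
    rfl
  have hp0 : (p : ℤ) ≠ 0 := by exact_mod_cast hp.ne_zero
  have hq0 : (q : ℤ) ≠ 0 := by exact_mod_cast hq.ne_zero
  rcases hU' with hU | hU <;> rcases hV with hV | hV | hV | hV
  · exact .inl ⟨hU, hV⟩
  · exact (hbad (α := 1) (β := -1) (by simp) (by simp) (by simpa using hU) (by simpa using hV)
      (.inl (by decide))).elim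
  · exact (hbad (α := 1) (β := q) (by simp) hq0 (by simpa using hU) hV
      (.inl (by simpa using hq'))).elim
  · exact .inr (.inr (.inl ⟨hU, hV⟩))
  · exact (hbad (α := p) (β := 1) hp0 (by simp) hU (by simpa using hV)
      (.inr (by simpa using hp'))).elim
  · exact .inr (.inr (.inr ⟨hU, hV⟩))
  · exact .inr (.inl ⟨hU, hV⟩)
  · exact (hbad (α := p) (β := -q) hp0 (by simpa using hq0) hU (by simpa using hV)
      (.inr (by simp [hp', hq']; decide))).elim

end Descent

lemma Rat.isSquare_of_isSquare_mul {a b : ℚ} (ha : a ≠ 0) (h : IsSquare a)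
    (hab : IsSquare (a * b)) : IsSquare b := by
  rw [← mul_div_cancel_left₀ b ha]
  exact hab.div h

namespace jacCurve

/-- Rational points on `y² = x(x + q)(x + p)` in terms of integers. -/
lemma exists_int_of_sq_eq {p q : ℕ} {x y : ℚ} (hy : y ≠ 0) (h : y ^ 2 = x * (x + q) * (x + p)) :
    ∃ m d c : ℤ, IsCoprime m d ∧ d ≠ 0 ∧ c ≠ 0 ∧ x = m / d ^ 2 ∧
      m * (m + q * d ^ 2) * (m + p * d ^ 2) = c ^ 2 := by
  set m := x.num with hm
  set n : ℤ := (x.den : ℤ) with hn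
  have hn0 : (n : ℚ) ≠ 0 := by simp [hn]
  have hx : x = m / n := (Rat.num_div_den x).symm
  have hmn : IsCoprime m n := by
    rw [Int.isCoprime_iff_nat_coprime]
    simpa [hn] using x.reduced
  have hsq : IsSquare ((n * (m * (m + q * n) * (m + p * n)) : ℤ) : ℚ) := by
    refine ⟨y * n ^ 2, ?_⟩
    rw [show y * n ^ 2 * (y * n ^ 2) = y ^ 2 * n ^ 4 by ring, h, hx]
    push_cast
    field_simp
  obtain ⟨c, hc⟩ := Rat.isSquare_intCast_iff.mp hsq
  have hcop (r : ℤ) : IsCoprime n (m + r * n) := by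
    rw [mul_comm]
    exact (IsCoprime.add_mul_left_right_iff).mpr hmn.symm
  have hcop' : IsCoprime n (m * (m + q * n) * (m + p * n)) :=
    (hmn.symm.mul_right (hcop q)).mul_right (hcop p)
  obtain ⟨d, hd⟩ := Int.sq_of_isCoprime hcop' (hc.trans (sq c).symm)
  have hnpos : 0 < n := by simp [hn, x.den_pos]
  have hd : n = d ^ 2 := by
    rcases hd with hd | hd
    · exact hd
    · linarith [sq_nonneg d]
  have hd0 : d ≠ 0 := by
    rintro rfl
    simp [hd] at hnpos
  rw [hd] at hc hmn hx hsq
  obtain ⟨e, he⟩ := Int.isSquare_of_mul_sq (c := c)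
    (a := m * (m + q * d ^ 2) * (m + p * d ^ 2)) hd0 (by linear_combination hc)
  rw [IsCoprime.pow_right_iff two_pos] at hmn
  refine ⟨m, d, e, hmn, hd0, ?_, by rw [hx]; push_cast; rfl, by rw [he, sq]⟩
  rintro rfl
  have : y ^ 2 * d ^ 6 = 0 := by
    have he := congrArg (Int.cast (R := ℚ)) he
    push_cast at he
    have hdq : (d : ℚ) ≠ 0 := by exact_mod_cast hd0
    rw [h, hx]
    push_cast
    field_simp
    linear_combination he
  simp [hy, hd0] at this

lemma descent_rat {p q : ℕ} (hp : p.Prime) (hq : q.Prime) (hpq : p = q + 4) (hq4 : q % 4 = 3)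
    {x y : ℚ} (hy : y ≠ 0) (h : y ^ 2 = x * (x + q) * (x + p))
    (h2 : Even (padicValRat 2 (x + p))) :
    IsSquare (x + p) ∧ IsSquare (x + q) ∨
    IsSquare (p * (x + p)) ∧ IsSquare (q * (x + q)) ∨
    IsSquare (x + p) ∧ IsSquare (-(q * (x + q))) ∨
    IsSquare (p * (x + p)) ∧ IsSquare (-(x + q)) := by
  obtain ⟨m, d, c, hmd, hd, hc, hx, hm⟩ := exists_int_of_sq_eq hy h
  have hdq : (d : ℚ) ≠ 0 := by exact_mod_cast hd
  have hX (r : ℕ) : x + r = ((m + r * d ^ 2 : ℤ) : ℚ) / d ^ 2 := by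
    rw [hx]
    push_cast
    field_simp
  have hsq {r : ℕ} {α : ℤ} (hα : IsSquare (α * (m + r * d ^ 2))) : IsSquare (α * (x + r)) := by
    rw [hX, ← mul_div_assoc]
    obtain ⟨s, hs⟩ := hα
    exact ⟨s / d, by rw [div_mul_div_comm, ← sq (d : ℚ)]; congr 1; exact_mod_cast hs⟩
  have hM0 : m * (m + q * d ^ 2) * (m + p * d ^ 2) ≠ 0 := hm ▸ pow_ne_zero 2 hc
  rw [hX, padicValRat.div (by exact_mod_cast right_ne_zero_of_mul hM0) (pow_ne_zero 2 hdq),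
    padicValRat.pow, padicValRat.of_int, Int.even_sub] at h2
  have h2 := h2.mpr (by simp)
  rcases descent_int hp hq hpq hq4 hmd hc hm (by exact_mod_cast h2) with h | h | h | h
  · exact .inl ⟨by simpa using hsq (α := 1) (by simpa using h.1),
      by simpa using hsq (α := 1) (by simpa using h.2)⟩
  · exact .inr (.inl ⟨by simpa using hsq (α := p) h.1, by simpa using hsq (α := q) h.2⟩)
  · exact .inr (.inr (.inl ⟨by simpa using hsq (α := 1) (by simpa using h.1),
      by simpa using hsq (α := -q) (by simpa using h.2)⟩))
  · exact .inr (.inr (.inr ⟨by simpa using hsq (α := p) h.1,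
      by simpa using hsq (α := -1) (by simpa using h.2)⟩))

section Points

variable {b : ℤ} {x y : ℚ}

lemma add_self_eq_zero_iff {h : (jacCurve b).Nonsingular x y} :
    Point.some x y h + Point.some x y h = 0 ↔ y = 0 := by
  rw [← eq_neg_iff_add_eq_zero, Point.neg_some, Point.some.injEq]
  simp only [negY, jacCurve, true_and]
  constructor <;> intro h
  · linear_combination h / 2
  · rw [h]; ring

/-- Translating by a point of order two to land in the image of doubling. -/
lemma exists_eq_add_of_torsion (hb : b ^ 2 ≠ 4) {h : (jacCurve b).Nonsingular x y} (hy : y ≠ 0)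
    {e : ℚ} (he : e * (e + b - 2) * (e + b + 2) = 0)
    (H : ∀ e' : ℚ, e' * (e' + b - 2) * (e' + b + 2) = 0 → e' ≠ e → IsSquare ((x - e') * (e - e'))) :
    ∃ t R : (jacCurve b).Point, t + t = 0 ∧ Point.some x y h = t + (R + R) := by
  have hT : (jacCurve b).Nonsingular e 0 := jacCurve_nonsingular hb (by rw [he]; ring)
  have hT2 : Point.some e 0 hT + Point.some e 0 hT = 0 := add_self_eq_zero_iff.mpr rfl
  have hexy := jacCurve_equation.mp h.1
  have hxe : x ≠ e := by
    rintro rfl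
    exact hy (by simpa [he] using hexy)
  refine ⟨.some e 0 hT, ?_⟩
  generalize hS : Point.some x y h + Point.some e 0 hT = S
  have hSP : Point.some x y h = Point.some e 0 hT + S := by
    rw [← hS, add_left_comm, hT2, add_zero]
  rcases S with _ | ⟨x₃, y₃, h₃⟩
  · exact ⟨0, hT2, by rw [hSP, ← Point.zero_def, add_zero, add_zero, add_zero]⟩
  have hy₃ : y₃ ≠ 0 := by
    rintro rfl
    refine hy ((add_self_eq_zero_iff (h := h)).mp ?_)
    rw [hSP, add_add_add_comm, hT2, add_self_eq_zero_iff.mpr rfl, zero_add]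
  have heq₃ := jacCurve_equation.mp h₃.1
  have key (e' : ℚ) (he' : e' * (e' + b - 2) * (e' + b + 2) = 0) (hne : e' ≠ e) :
      IsSquare (x₃ - e') ∧ x₃ - e' ≠ 0 := by
    constructor
    · obtain ⟨s, hs⟩ := exists_sq_eq_of_add he' hxe hS
      refine Rat.isSquare_of_isSquare_mul ?_ (H e' he' hne) ⟨s, by rw [hs, sq]⟩
      refine mul_ne_zero (sub_ne_zero.mpr ?_) (sub_ne_zero.mpr hne.symm)
      rintro rfl
      exact hy (by simpa [he'] using hexy)
    · rw [sub_ne_zero]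
      rintro rfl
      exact hy₃ (by simpa [he'] using heq₃)
  have hb₁ : (b : ℚ) - 2 ≠ 0 := fun h0 ↦ hb (by
    have : b = 2 := by exact_mod_cast sub_eq_zero.mp h0
    rw [this]; norm_num)
  have hb₂ : (b : ℚ) + 2 ≠ 0 := fun h0 ↦ hb (by
    have : b = -2 := by exact_mod_cast eq_neg_of_add_eq_zero_left h0
    rw [this]; norm_num)
  have hsq : IsSquare (y₃ ^ 2) := ⟨y₃, sq y₃⟩
  obtain ⟨R, hR⟩ : ∃ R, Point.some x₃ y₃ h₃ = R + R := by
    rcases mul_eq_zero.mp he with he | he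
    · rcases mul_eq_zero.mp he with he | he
      · obtain ⟨k₁, n₁⟩ := key (2 - b) (by ring) (fun h0 ↦ hb₁ (by linear_combination -h0 - he))
        obtain ⟨k₂, n₂⟩ := key (-2 - b) (by ring) (fun h0 ↦ hb₂ (by linear_combination -h0 - he))
        rw [show x₃ - (2 - b) = x₃ + b - 2 by ring] at k₁ n₁
        rw [show x₃ - (-2 - b) = x₃ + b + 2 by ring] at k₂ n₂
        refine exists_add_self_eq hb h₃ ?_ k₁ k₂
        refine Rat.isSquare_of_isSquare_mul (mul_ne_zero n₁ n₂) (k₁.mul k₂) ?_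
        convert hsq using 1
        rw [heq₃]
        ring
      · obtain ⟨k₁, n₁⟩ := key 0 (by ring) (fun h0 ↦ hb₁ (by linear_combination h0 + he))
        obtain ⟨k₂, n₂⟩ := key (-2 - b) (by ring) (fun h0 ↦ by
          have : (4 : ℚ) = 0 := by linear_combination -h0 - he
          norm_num at this)
        rw [sub_zero] at k₁ n₁
        rw [show x₃ - (-2 - b) = x₃ + b + 2 by ring] at k₂ n₂
        refine exists_add_self_eq hb h₃ k₁ ?_ k₂
        refine Rat.isSquare_of_isSquare_mul (mul_ne_zero n₁ n₂) (k₁.mul k₂) ?_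
        convert hsq using 1
        rw [heq₃]
        ring
    · obtain ⟨k₁, n₁⟩ := key 0 (by ring) (fun h0 ↦ hb₂ (by linear_combination h0 + he))
      obtain ⟨k₂, n₂⟩ := key (2 - b) (by ring) (fun h0 ↦ by
        have : (4 : ℚ) = 0 := by linear_combination h0 + he
        norm_num at this)
      rw [sub_zero] at k₁ n₁
      rw [show x₃ - (2 - b) = x₃ + b - 2 by ring] at k₂ n₂
      refine exists_add_self_eq hb h₃ k₁ k₂ ?_
      refine Rat.isSquare_of_isSquare_mul (mul_ne_zero n₁ n₂) (k₁.mul k₂) ?_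
      rwa [← heq₃]
  exact ⟨R, hT2, by rw [hSP, hR]⟩

variable {p q : ℕ}

lemma exists_eq_torsion_add (hp : p.Prime) (hq : q.Prime) (hbp : b + 2 = p) (hbq : b - 2 = q)
    (hq4 : q % 4 = 3) {h : (jacCurve b).Nonsingular x y} (hy : y ≠ 0)
    (h2 : Even (padicValRat 2 (x + b + 2))) :
    ∃ t R : (jacCurve b).Point, t + t = 0 ∧ Point.some x y h = t + (R + R) := by
  have hbp' : (b : ℚ) + 2 = p := by exact_mod_cast hbp
  have hbq' : (b : ℚ) - 2 = q := by exact_mod_cast hbq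
  have hp0 : (p : ℚ) ≠ 0 := by exact_mod_cast hp.ne_zero
  have hq0 : (q : ℚ) ≠ 0 := by exact_mod_cast hq.ne_zero
  have hb : b ^ 2 ≠ 4 := fun h0 ↦ by
    have : (p : ℤ) * q = 0 := by rw [← hbp, ← hbq]; linear_combination h0
    simp [hp.ne_zero, hq.ne_zero] at this
  have hxy := jacCurve_equation.mp h.1
  rw [add_sub_assoc, add_assoc x, hbp', hbq'] at hxy
  rw [add_assoc, hbp'] at h2
  have hroot (e' : ℚ) (he' : e' * (e' + b - 2) * (e' + b + 2) = 0) :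
      e' = 0 ∨ e' = -q ∨ e' = -p := by
    rw [← hbp', ← hbq']
    rcases mul_eq_zero.mp he' with he | he
    · rcases mul_eq_zero.mp he with he | he
      · exact .inl he
      · exact .inr (.inl (by linear_combination he))
    · exact .inr (.inr (by linear_combination he))
  have hne : x * (x + q) * (x + p) ≠ 0 := hxy ▸ pow_ne_zero 2 hy
  have hsq : IsSquare (y ^ 2) := ⟨y, sq y⟩
  have h4 : IsSquare (4 : ℚ) := ⟨2, by norm_num⟩
  have hpq4 : (p : ℚ) = q + 4 := by rw [← hbp', ← hbq']; ring
  have third {α β : ℚ} (hα : α ≠ 0) (hβ : β ≠ 0) (k₁ : IsSquare (α * (x + p)))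
      (k₂ : IsSquare (β * (x + q))) : IsSquare (α * β * x) := by
    refine Rat.isSquare_of_isSquare_mul ?_ (k₁.mul k₂) ?_
    · exact mul_ne_zero (mul_ne_zero hα (right_ne_zero_of_mul hne))
        (mul_ne_zero hβ (right_ne_zero_of_mul (left_ne_zero_of_mul hne)))
    · rw [show α * (x + p) * (β * (x + q)) * (α * β * x) = y ^ 2 * (α * β * (α * β)) by
        rw [hxy]; ring]
      exact hsq.mul (IsSquare.mul_self (α * β))
  rcases descent_rat hp hq (by omega) hq4 hy hxy h2 with ⟨k₁, k₂⟩ | ⟨k₁, k₂⟩ | ⟨k₁, k₂⟩ | ⟨k₁, k₂⟩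
  · have k₃ := third (α := 1) (β := 1) (by simp) (by simp) (by simpa using k₁) (by simpa using k₂)
    obtain ⟨R, hR⟩ := exists_add_self_eq hb h (by simpa using k₃)
      (by rwa [add_sub_assoc, hbq']) (by rwa [add_assoc, hbp'])
    exact ⟨0, R, by simp, by simpa using hR⟩
  · refine exists_eq_add_of_torsion hb hy (e := 0) (by ring) fun e' he' hn ↦ ?_
    rcases hroot e' he' with rfl | rfl | rfl
    · exact absurd rfl hn
    · convert k₂ using 1; ring
    · convert k₁ using 1; ring
  · have k₃ := third (α := 1) (β := -q) (by simp) (by simpa using hq0) (by simpa using k₁)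
      (by simpa using k₂)
    refine exists_eq_add_of_torsion hb hy (e := -q) (by rw [← hbq']; ring) fun e' he' hn ↦ ?_
    rcases hroot e' he' with rfl | rfl | rfl
    · convert k₃ using 1; ring
    · exact absurd rfl hn
    · rw [show (x - -p) * (-q - -p) = (x + p) * 4 by rw [hpq4]; ring]
      exact k₁.mul h4
  · have k₃ := third (α := p) (β := -1) hp0 (by simp) k₁ (by simpa using k₂)
    refine exists_eq_add_of_torsion hb hy (e := -p) (by rw [← hbp']; ring) fun e' he' hn ↦ ?_
    rcases hroot e' he' with rfl | rfl | rfl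
    · convert k₃ using 1; ring
    · rw [show (x - -q) * (-p - -q) = -(x + q) * 4 by rw [hpq4]; ring]
      exact k₂.mul h4
    · exact absurd rfl hn

lemma nonsingular_neg_self {a : ℤ} (hb : b ^ 2 ≠ 4) (hab : b = a ^ 2) :
    (jacCurve b).Nonsingular (-b) (2 * a) :=
  jacCurve_nonsingular hb (by rw [hab]; push_cast; ring)

lemma exists_eq_add_torsion_add {a : ℤ} (hb : b ^ 2 ≠ 4) (hab : b = a ^ 2) (hp : p.Prime)
    (hq : q.Prime) (hbp : b + 2 = p) (hbq : b - 2 = q) (hq4 : q % 4 = 3)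
    {h : (jacCurve b).Nonsingular x y} (hy : y ≠ 0) (h2 : ¬ Even (padicValRat 2 (x + b + 2))) :
    ∃ t R : (jacCurve b).Point, t + t = 0 ∧
      Point.some x y h = Point.some _ _ (nonsingular_neg_self hb hab) + t + (R + R) := by
  set D := Point.some _ _ (nonsingular_neg_self hb hab)
  generalize hS : Point.some x y h + D = S
  have hSP : Point.some x y h = D + (S + (-D + -D)) := by
    rw [← hS]
    abel
  by_cases hx : x = -b
  · rcases (Point.X_eq_iff (h₁ := h) (h₂ := nonsingular_neg_self hb hab)).mp hx with h1 | h1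
    · exact ⟨0, 0, by simp, by rw [h1]; simp [D]⟩
    · exact ⟨0, -D, by simp, by rw [h1]; simp only [D]; abel⟩
  rcases S with _ | ⟨x₃, y₃, h₃⟩
  · exact ⟨0, -D, by simp, by rw [hSP, ← Point.zero_def]; abel⟩
  by_cases hy₃ : y₃ = 0
  · subst hy₃
    exact ⟨_, -D, add_self_eq_zero_iff.mpr rfl, by rw [hSP, add_assoc]⟩
  obtain ⟨t, R, ht, hR⟩ := exists_eq_torsion_add hp hq hbp hbq hq4 (h := h₃) hy₃ (by
    obtain ⟨s, hs⟩ := exists_sq_eq_of_add (e := -2 - b) (by ring) hx hS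
    have hxe : x + b + 2 ≠ 0 := fun h0 ↦ hy (by simpa [h0] using jacCurve_equation.mp h.1)
    have hxe₃ : x₃ + b + 2 ≠ 0 := fun h0 ↦ hy₃ (by simpa [h0] using jacCurve_equation.mp h₃.1)
    have e1 : 2 * ((x + b + 2) * (x₃ + b + 2)) = s ^ 2 := by rw [← hs]; ring
    have e2 := congrArg (padicValRat 2) e1
    rw [padicValRat.mul two_ne_zero (mul_ne_zero hxe hxe₃), padicValRat.mul hxe hxe₃,
      padicValRat.pow, show padicValRat 2 2 = 1 from padicValRat.self one_lt_two] at e2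
    obtain ⟨k, hk⟩ := Int.not_even_iff_odd.mp h2
    rw [hk] at e2
    refine ⟨padicValRat 2 s - k - 1, ?_⟩
    push_cast at e2
    linarith)
  refine ⟨t, R - D, ht, ?_⟩
  rw [hSP, hR]
  abel

end Points
end jacCurve

section RatReduction

variable (l : ℕ) [hl : Fact l.Prime]

/-- The rational numbers whose denominator is prime to `l`. -/
def Rat.integralAt : Subring ℚ where
  carrier := {x | ¬ l ∣ x.den}
  zero_mem' := by simpa using hl.out.ne_one
  one_mem' := by simpa using hl.out.ne_one
  add_mem' {x y} hx hy h := (hl.out.dvd_mul.mp (h.trans (Rat.add_den_dvd x y))).elim hx hy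
  mul_mem' {x y} hx hy h := (hl.out.dvd_mul.mp (h.trans (Rat.mul_den_dvd x y))).elim hx hy
  neg_mem' {x} hx := by simpa using hx

lemma Rat.den_cast_ne_zero_of_mem {x : ℚ} (hx : x ∈ Rat.integralAt l) : (x.den : ZMod l) ≠ 0 :=
  fun h ↦ hx ((ZMod.natCast_eq_zero_iff _ _).mp h)

/-- Reduction modulo `l`. -/
def Rat.reduction : Rat.integralAt l →+* ZMod l where
  toFun x := ((x : ℚ) : ZMod l)
  map_zero' := Rat.cast_zero
  map_one' := Rat.cast_one
  map_add' x y := Rat.cast_add_of_ne_zero (Rat.den_cast_ne_zero_of_mem l x.2)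
    (Rat.den_cast_ne_zero_of_mem l y.2)
  map_mul' x y := Rat.cast_mul_of_ne_zero (Rat.den_cast_ne_zero_of_mem l x.2)
    (Rat.den_cast_ne_zero_of_mem l y.2)

lemma Rat.reduction_inv_eq_zero (x : ℚ) (hx : x ∉ Rat.integralAt l) :
    ∃ h : x⁻¹ ∈ Rat.integralAt l, Rat.reduction l ⟨x⁻¹, h⟩ = 0 := by
  have hx : l ∣ x.den := not_not.mp hx
  have hx0 : x ≠ 0 := by
    rintro rfl
    exact hl.out.ne_one (by simpa using hx)
  have hnum : ¬ l ∣ x.num.natAbs := fun h ↦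
    hl.out.ne_one (Nat.dvd_one.mp (x.reduced ▸ Nat.dvd_gcd h hx))
  have hnum' : (x.num : ZMod l) ≠ 0 := fun h ↦
    hnum (Int.natCast_dvd.mp ((ZMod.intCast_zmod_eq_zero_iff_dvd _ _).mp h))
  have hmem : x⁻¹ ∈ Rat.integralAt l := by
    change ¬ l ∣ x⁻¹.den
    rwa [Rat.den_inv_of_ne_zero hx0]
  refine ⟨hmem, ?_⟩
  have h1 : Rat.reduction l (⟨x⁻¹, hmem⟩ * (x.num : Rat.integralAt l)) =
      Rat.reduction l (x.den : Rat.integralAt l) := by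
    congr 1
    refine Subtype.ext ?_
    push_cast
    nth_rw 1 [← Rat.num_div_den x]
    have := Rat.num_ne_zero.mpr hx0
    field_simp
  rw [map_mul, map_intCast, map_natCast, (ZMod.natCast_eq_zero_iff _ _).mpr hx] at h1
  exact (mul_eq_zero.mp h1).resolve_right hnum'

variable {l}

lemma Rat.mem_integralAt_of_mul {x : ℚ} {i j : ℤ} (h : x * j = i) (hj : ¬ (l : ℤ) ∣ j) :
    x ∈ Rat.integralAt l := by
  have hj0 : (j : ℚ) ≠ 0 := by
    rintro h0
    simp [Int.cast_eq_zero.mp h0] at hj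
  rw [eq_div_of_mul_eq hj0 h, ← Rat.divInt_eq_div]
  exact fun hd ↦ hj ((Int.natCast_dvd_natCast.mpr hd).trans (Rat.den_dvd i j))

lemma Rat.reduction_eq_zero_of_mul {x : Rat.integralAt l} {i j : ℤ} (h : (x : ℚ) * j = i)
    (hj : ¬ (l : ℤ) ∣ j) (hi : (l : ℤ) ∣ i) : Rat.reduction l x = 0 := by
  have h1 : x * (j : Rat.integralAt l) = i := Subtype.ext (by simpa using h)
  have h1 := congrArg (Rat.reduction l) h1
  rw [map_mul, map_intCast, map_intCast, (ZMod.intCast_zmod_eq_zero_iff_dvd _ _).mpr hi] at h1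
  exact (mul_eq_zero.mp h1).resolve_right fun h0 ↦
    hj ((ZMod.intCast_zmod_eq_zero_iff_dvd _ _).mp h0)

end RatReduction

namespace jacCurve

section

variable {a b : ℤ} {p q : ℕ}

/-- The curve has rank at most one, modulo torsion. -/
lemma exists_eq_zsmul_add (hb : b ^ 2 ≠ 4) (hab : b = a ^ 2) (hp : p.Prime)
    (hq : q.Prime) (hbp : b + 2 = p) (hbq : b - 2 = q) (hq4 : q % 4 = 3) (P : (jacCurve b).Point) :
    ∃ (n : ℤ) (t R : (jacCurve b).Point), t + t = 0 ∧
      P = n • Point.some _ _ (nonsingular_neg_self hb hab) + t + (R + R) := by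
  rcases P with _ | ⟨x, y, h⟩
  · exact ⟨0, 0, 0, by simp, by simp [← Point.zero_def]⟩
  by_cases hy : y = 0
  · subst hy
    exact ⟨0, .some x 0 h, 0, add_self_eq_zero_iff.mpr rfl, by simp⟩
  by_cases h2 : Even (padicValRat 2 (x + b + 2))
  · obtain ⟨t, R, ht, hR⟩ := exists_eq_torsion_add hp hq hbp hbq hq4 (h := h) hy h2
    exact ⟨0, t, R, ht, by simp [hR]⟩
  · obtain ⟨t, R, ht, hR⟩ := exists_eq_add_torsion_add hb hab hp hq hbp hbq hq4 (h := h) hy h2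
    exact ⟨1, t, R, ht, by simp [hR]⟩

lemma add_self_mem_redKernel {k : Type*} [Field k] [Finite k] {A : Subring ℚ} {φ : A →+* k}
    (hφ : ∀ x ∉ A, ∃ h : x⁻¹ ∈ A, φ ⟨x⁻¹, h⟩ = 0) (hk : φ (4 * ((b : A) ^ 2 - 4)) ≠ 0)
    {D P₁ P₂ t₁ t₂ R₁ R₂ : (jacCurve b).Point}
    (hD : ∀ P : (jacCurve b).Point, ∃ (n : ℤ) (t R : (jacCurve b).Point), t + t = 0 ∧
      P = n • D + t + (R + R))
    (ht₁ : t₁ + t₁ = 0) (ht₂ : t₂ + t₂ = 0) (h₁ : P₁ = t₁ + (R₁ + R₁))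
    (h₂ : P₂ = D + t₂ + (R₂ + R₂)) (hm₁ : P₁ + P₁ ∈ redKernel hφ) (hm₂ : P₂ + P₂ ∈ redKernel hφ) :
    R₁ + R₁ ∈ redKernel hφ := by
  have := finite_quotient_redKernel (b := b) hφ hk
  let π := QuotientAddGroup.mk' (redKernel (b := b) hφ)
  have hπ (x : (jacCurve b).Point) : π x = 0 ↔ x ∈ redKernel hφ :=
    QuotientAddGroup.eq_zero_iff x
  rw [← hπ, map_add]
  refine add_self_eq_zero_of_four (d := π D) ⟨π (-R₂), ?_⟩ (fun h ↦ ?_) ?_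
  · rw [← sub_eq_zero]
    simp only [← map_add, ← map_sub, hπ]
    convert hm₂ using 1
    rw [← sub_zero (P₂ + P₂), ← ht₂, h₂]
    abel
  · obtain ⟨P, rfl⟩ := QuotientAddGroup.mk'_surjective _ h
    obtain ⟨n, t, R, ht, hR⟩ := hD P
    refine ⟨n, π R, ?_⟩
    change π P + π P = _
    simp only [← map_add, ← map_zsmul]
    congr 1
    rw [hR, ← add_zero (n • (D + D)), ← ht, zsmul_add]
    abel
  · simp only [← map_add, hπ]
    convert hm₁ using 1
    rw [← sub_zero (P₁ + P₁), ← ht₁, h₁]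
    abel

lemma eq_zero_or_of_add_self_eq_zero {t : (jacCurve b).Point} (ht : t + t = 0) :
    t = 0 ∨ ∃ e h, t = Point.some e 0 h ∧ (e = 0 ∨ e = 2 - b ∨ e = -2 - b) := by
  rcases t with _ | ⟨e, y, h⟩
  · exact .inl rfl
  · obtain rfl := add_self_eq_zero_iff.mp ht
    refine .inr ⟨e, h, rfl, ?_⟩
    have he := jacCurve_equation.mp h.1
    rcases mul_eq_zero.mp (he.symm.trans (by norm_num)) with he | he
    · rcases mul_eq_zero.mp he with he | he
      · exact .inl he
      · exact .inr (.inl (by linear_combination he))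
    · exact .inr (.inr (by linear_combination he))

end
end jacCurve

section Quadruple

variable {b X Y Z A B : ℤ}

lemma sq_ne_sq_of_quadruple (hb : b ^ 2 ≠ 4) (h₁ : A ^ 2 + B ^ 2 = Z ^ 2)
    (h₂ : X ^ 2 + Y ^ 2 = Z ^ 2) (h₃ : 4 * (A ^ 2 * B ^ 2) = b ^ 2 * (X ^ 2 * Y ^ 2))
    (hX : X ≠ 0) (hY : Y ≠ 0) : A ^ 2 ≠ X ^ 2 := fun h ↦ by
  have hB : B ^ 2 = Y ^ 2 := by linear_combination h₁ - h₂ - h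
  rw [h, hB] at h₃
  exact hb (mul_right_cancel₀ (mul_ne_zero (pow_ne_zero 2 hX) (pow_ne_zero 2 hY)) h₃.symm)

lemma exists_prime_dvd_add (hb : b ^ 2 ≠ 4) (h₁ : A ^ 2 + B ^ 2 = Z ^ 2)
    (h₂ : X ^ 2 + Y ^ 2 = Z ^ 2) (h₃ : 4 * (A ^ 2 * B ^ 2) = b ^ 2 * (X ^ 2 * Y ^ 2))
    (hX : X ≠ 0) (hY : Y ≠ 0) (hA : Even A) (hB : Odd B) (hYo : Odd Y) :
    ∃ l : ℕ, l.Prime ∧ (l : ℤ) ∣ Z ∧ (l : ℤ) ∣ B * Y + A * X := by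
  by_contra! hcon
  have hZ : Z ≠ 0 := by
    rintro rfl
    have : X ^ 2 = 0 := by nlinarith [sq_nonneg X, sq_nonneg Y]
    exact hX (by simpa using this)
  have hcop : IsCoprime Z (B * Y + A * X) := by
    rw [Int.isCoprime_iff_gcd_eq_one]
    by_contra hne
    obtain ⟨l, hl, hd⟩ := Nat.exists_prime_and_dvd hne
    have hd := Int.natCast_dvd_natCast.mpr hd
    exact hcon l hl (hd.trans (Int.gcd_dvd_left _ _)) (hd.trans (Int.gcd_dvd_right _ _))
  obtain ⟨k, hk⟩ : Z ^ 2 ∣ B * Y - A * X := by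
    refine (hcop.pow_left (m := 2)).dvd_of_dvd_mul_left ⟨Y ^ 2 - A ^ 2, ?_⟩
    linear_combination Y ^ 2 * h₁ - A ^ 2 * h₂
  have hodd : Odd (B * Y - A * X) := (hB.mul hYo).sub_even (hA.mul_right X)
  have hk0 : k ≠ 0 := by
    rintro rfl
    rw [hk] at hodd
    simp at hodd
  have hsum : (B * Y - A * X) ^ 2 + (B * X + A * Y) ^ 2 = Z ^ 4 := by
    linear_combination (X ^ 2 + Y ^ 2) * h₁ + Z ^ 2 * h₂
  have hZ4 : 0 < Z ^ 4 := by positivity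
  have hk1 : 1 ≤ k ^ 2 := by
    have : 0 < k ^ 2 := by positivity
    omega
  have hBX : (B * X + A * Y) ^ 2 ≤ 0 := by
    rw [hk] at hsum
    nlinarith
  have hBX : B * X + A * Y = 0 := by
    have := le_antisymm hBX (sq_nonneg _)
    simpa using this
  refine sq_ne_sq_of_quadruple hb h₁ h₂ h₃ hX hY (mul_left_cancel₀ (pow_ne_zero 2 hZ) ?_)
  linear_combination (-(B * X - A * Y)) * hBX + X ^ 2 * h₁ - A ^ 2 * h₂

end Quadruple

namespace jacCurve

variable {a b X Y Z A B : ℤ} {p q : ℕ}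

lemma exists_point_of_quadruple (ha : a ≠ 0) (hb : b ^ 2 ≠ 4) (hab : b = a ^ 2)
    (h₁ : A ^ 2 + B ^ 2 = Z ^ 2) (h₂ : X ^ 2 + Y ^ 2 = Z ^ 2) (h₃ : 2 * (A * B) = b * (X * Y))
    (hX : X ≠ 0) (hY : Y ≠ 0) (hB : B ≠ 0) (hZ : Z ≠ 0) : ∃ x y : ℚ,
      y ≠ 0 ∧ (jacCurve b).Nonsingular x y ∧ x * (b * X ^ 2) = 4 * B ^ 2 - b ^ 2 * X ^ 2 ∧
      (x + b + 2) * (b * X ^ 2 * Y) = 4 * B * (B * Y + A * X) ∧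
      (x + b - 2) * (b * X ^ 2 * Y) = 4 * B * (B * Y - A * X) := by
  have hne := sq_ne_sq_of_quadruple hb h₁ (Y := X) (X := Y) (by linear_combination h₂)
    (by linear_combination (2 * (A * B) + b * (X * Y)) * h₃) hY hX
  have hne' : (Y : ℚ) ^ 2 - A ^ 2 ≠ 0 := sub_ne_zero.mpr (by exact_mod_cast hne.symm)
  have ha' : (a : ℚ) ≠ 0 := by exact_mod_cast ha
  have hX' : (X : ℚ) ≠ 0 := by exact_mod_cast hX
  have hY' : (Y : ℚ) ≠ 0 := by exact_mod_cast hY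
  have hB' : (B : ℚ) ≠ 0 := by exact_mod_cast hB
  have hZ' : (Z : ℚ) ≠ 0 := by exact_mod_cast hZ
  have h₁ : (A : ℚ) ^ 2 + B ^ 2 = Z ^ 2 := by exact_mod_cast h₁
  have h₂ : (X : ℚ) ^ 2 + Y ^ 2 = Z ^ 2 := by exact_mod_cast h₂
  have h₃ : 2 * ((A : ℚ) * B) = b * (X * Y) := by exact_mod_cast h₃
  have hab' : (b : ℚ) = a ^ 2 := by exact_mod_cast hab
  have hb' : (b : ℚ) ≠ 0 := by rw [hab']; positivity
  set x : ℚ := 4 * B ^ 2 / (b * X ^ 2) - b with hx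
  have e₁ : x * (b * X ^ 2) = 4 * B ^ 2 - b ^ 2 * X ^ 2 := by
    rw [hx]
    field_simp
  have e₂ : (x + b + 2) * (b * X ^ 2 * Y) = 4 * B * (B * Y + A * X) := by
    linear_combination Y * e₁ - 2 * X * h₃
  have e₃ : (x + b - 2) * (b * X ^ 2 * Y) = 4 * B * (B * Y - A * X) := by
    linear_combination Y * e₁ + 2 * X * h₃
  have e₄ : x * (b * X ^ 2 * Y ^ 2) = 4 * B ^ 2 * (Y ^ 2 - A ^ 2) := by
    linear_combination Y ^ 2 * e₁ + (2 * (A * B) + b * (X * Y)) * h₃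
  refine ⟨x, 8 * B ^ 2 * Z * (Y ^ 2 - A ^ 2) / (a ^ 3 * X ^ 3 * Y ^ 2), by positivity,
    jacCurve_nonsingular hb ?_, e₁, e₂, e₃⟩
  have hM : (b : ℚ) ^ 3 * X ^ 6 * Y ^ 4 ≠ 0 := by positivity
  refine mul_right_cancel₀ hM ?_
  rw [show x * (x + b - 2) * (x + b + 2) * (b ^ 3 * X ^ 6 * Y ^ 4) =
    x * (b * X ^ 2 * Y ^ 2) * ((x + b + 2) * (b * X ^ 2 * Y)) * ((x + b - 2) * (b * X ^ 2 * Y)) by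
    ring, e₂, e₃, e₄, hab']
  field_simp
  linear_combination (-64) * ((Y : ℚ) ^ 2 * h₁ - (A : ℚ) ^ 2 * h₂)

lemma not_even_padicValRat_of_odd {n : ℤ} (hn : Odd n) {r : ℚ} (hr : r ≠ 0) :
    Even (padicValRat 2 (n * r ^ 2)) ∧ ¬ Even (padicValRat 2 (2 * (n * r ^ 2))) := by
  have hn0 : (n : ℚ) ≠ 0 := by
    rintro h0
    simp [Int.cast_eq_zero.mp h0] at hn
  have h2 : padicValInt 2 n = 0 := padicValInt.eq_zero_of_not_dvd (by
    rw [Nat.cast_ofNat, ← even_iff_two_dvd]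
    exact Int.not_even_iff_odd.mpr hn)
  have h1 : Even (padicValRat 2 (n * r ^ 2)) := by
    rw [padicValRat.mul hn0 (pow_ne_zero 2 hr), padicValRat.pow, padicValRat.of_int, h2]
    simp
  refine ⟨h1, ?_⟩
  rw [padicValRat.mul two_ne_zero (mul_ne_zero hn0 (pow_ne_zero 2 hr)),
    show padicValRat 2 2 = 1 from padicValRat.self one_lt_two, Int.even_add]
  simp [h1]

theorem false_of_quadruple (hab : b = a ^ 2) (hp : p.Prime) (hq : q.Prime) (hbp : b + 2 = p)
    (hbq : b - 2 = q) (hq4 : q % 4 = 3) (hl4 : ∀ l : ℕ, l.Prime → (l : ℤ) ∣ a → l % 4 = 3)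
    (h₁ : A ^ 2 + B ^ 2 = Z ^ 2) (h₂ : X ^ 2 + Y ^ 2 = Z ^ 2) (h₃ : 2 * (A * B) = b * (X * Y))
    (hX : X ≠ 0) (hY : Y ≠ 0) (hXe : Even X) (hAe : Even A) (hco : IsCoprime X Z) : False := by
  have hb : b ^ 2 ≠ 4 := fun h0 ↦ by
    have : (p : ℤ) * q = 0 := by rw [← hbp, ← hbq]; linear_combination h0
    simp [hp.ne_zero, hq.ne_zero] at this
  have hbo : Odd b := by
    rw [Int.odd_iff]
    omega
  have ha : a ≠ 0 := by
    rintro rfl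
    simp [hab] at hbo
  have hb0 : b ≠ 0 := by simpa [hab] using ha
  have hAB : A * B ≠ 0 := fun h0 ↦ by simp [h0, hb0, hX, hY] at h₃
  have hA : A ≠ 0 := left_ne_zero_of_mul hAB
  have hB : B ≠ 0 := right_ne_zero_of_mul hAB
  have hZo : Odd Z := by
    by_contra hZ
    have := hco.isUnit_of_dvd' hXe.two_dvd (Int.not_odd_iff_even.mp hZ).two_dvd
    exact absurd this (by decide)
  have hZ : Z ≠ 0 := by
    rintro rfl
    simp at hZo
  have hBo : Odd B := by
    have : Odd (B ^ 2) := by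
      rw [show B ^ 2 = Z ^ 2 - A ^ 2 by linear_combination h₁]
      exact hZo.pow.sub_even (hAe.pow_of_ne_zero two_ne_zero)
    simpa [Int.odd_pow] using this
  have hYo : Odd Y := by
    have : Odd (Y ^ 2) := by
      rw [show Y ^ 2 = Z ^ 2 - X ^ 2 by linear_combination h₂]
      exact hZo.pow.sub_even (hXe.pow_of_ne_zero two_ne_zero)
    simpa [Int.odd_pow] using this
  -- primes dividing `Z`
  have hprime (l : ℕ) (hl : l.Prime) (hlZ : (l : ℤ) ∣ Z) :
      ¬ (l : ℤ) ∣ X ∧ ¬ (l : ℤ) ∣ Y ∧ ¬ (l : ℤ) ∣ b ∧ l ≠ 2 ∧ l ≠ p ∧ l ≠ q := by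
    have : Fact l.Prime := ⟨hl⟩
    have hl' := Nat.prime_iff_prime_int.mp hl
    have hlX : ¬ (l : ℤ) ∣ X := fun hlX ↦
      hl.ne_one (by simpa using Int.isUnit_iff_natAbs_eq.mp (hco.isUnit_of_dvd' hlX hlZ))
    have hlY : ¬ (l : ℤ) ∣ Y := fun hlY ↦ hlX (hl'.dvd_of_dvd_pow (n := 2) (by
      rw [show X ^ 2 = Z * Z - Y * Y by linear_combination h₂]
      exact dvd_sub (hlZ.mul_left _) (hlY.mul_left _)))
    have hmod : l % 4 ≠ 3 := by
      refine ZMod.mod_four_ne_three_of_sq_eq_neg_sq' (x := (X : ZMod l)) (y := (Y : ZMod l))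
        (fun h0 ↦ hlY ((ZMod.intCast_zmod_eq_zero_iff_dvd _ _).mp h0)) ?_
      have e := congrArg (Int.cast (R := ZMod l)) h₂
      push_cast at e
      rw [(ZMod.intCast_zmod_eq_zero_iff_dvd _ _).mpr hlZ] at e
      linear_combination e
    refine ⟨hlX, hlY, fun h ↦ hmod (hl4 l hl (hl'.dvd_of_dvd_pow (hab ▸ h))), ?_, ?_, ?_⟩
    · rintro rfl
      rw [Nat.cast_ofNat, ← even_iff_two_dvd] at hlZ
      exact Int.not_even_iff_odd.mpr hZo hlZ
    · rintro rfl
      exact hmod (by omega)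
    · rintro rfl
      exact hmod (by omega)
  obtain ⟨x₁, y₁, hy₁, hns₁, e₁, f₁, g₁⟩ :=
    exists_point_of_quadruple ha hb hab h₁ h₂ h₃ hX hY hB hZ
  obtain ⟨x₂, y₂, hy₂, hns₂, e₂, f₂, g₂⟩ :=
    exists_point_of_quadruple ha hb hab h₁ (X := Y) (Y := X) (by linear_combination h₂)
      (by linear_combination h₃) hY hX hB hZ
  have haq : (a : ℚ) ≠ 0 := by exact_mod_cast ha
  have hXq : (X : ℚ) ≠ 0 := by exact_mod_cast hX
  have hYq : (Y : ℚ) ≠ 0 := by exact_mod_cast hY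
  have habq : (b : ℚ) = a ^ 2 := by exact_mod_cast hab
  have hv₁ : Even (padicValRat 2 (x₁ + b + 2)) := by
    obtain ⟨k, hk⟩ := hXe.two_dvd
    have hn : Odd (B ^ 2 + 2 * (b * k ^ 2)) := hBo.pow.add_even (even_two_mul _)
    convert (not_even_padicValRat_of_odd hn (r := 2 / (a * X)) (by positivity)).1 using 2
    have hkq : (X : ℚ) = 2 * k := by exact_mod_cast hk
    have : (k : ℚ) ≠ 0 := by
      rintro h0
      simp [hkq, h0] at hXq
    rw [habq, hkq] at e₁
    rw [habq, hkq]
    push_cast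
    rw [habq]
    field_simp
    linear_combination e₁ / 4
  have hv₂ : ¬ Even (padicValRat 2 (x₂ + b + 2)) := by
    have hn : Odd (2 * B ^ 2 + b * Y ^ 2) := (even_two_mul _).add_odd (hbo.mul hYo.pow)
    convert (not_even_padicValRat_of_odd hn (r := 1 / (a * Y)) (by positivity)).2 using 3
    rw [habq] at e₂
    push_cast
    rw [habq]
    field_simp
    linear_combination e₂
  obtain ⟨t₁, R₁, ht₁, hR₁⟩ := exists_eq_torsion_add hp hq hbp hbq hq4 (h := hns₁) hy₁ hv₁
  obtain ⟨t₂, R₂, ht₂, hR₂⟩ :=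
    exists_eq_add_torsion_add hb hab hp hq hbp hbq hq4 (h := hns₂) hy₂ hv₂
  -- the contradiction modulo a suitable prime
  have main (l : ℕ) (hl : l.Prime) (hlZ : (l : ℤ) ∣ Z) (c : ℤ) (hc : c = 2 - b ∨ c = -2 - b)
      (hx : ∀ _ : Fact l.Prime, ∀ h : x₁ ∈ Rat.integralAt l,
        Rat.reduction l (⟨x₁, h⟩ - c) = 0)
      (hct : ∀ h : (jacCurve b).Nonsingular (c : ℚ) 0, t₁ ≠ Point.some (c : ℚ) 0 h) : False := by
    have hFl : Fact l.Prime := ⟨hl⟩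
    obtain ⟨hlX, hlY, hlb, hl2, hlp, hlq⟩ := hprime l hl hlZ
    have hl' := Nat.prime_iff_prime_int.mp hl
    have hnd {m n : ℤ} (hm : ¬ (l : ℤ) ∣ m) (hn : ¬ (l : ℤ) ∣ n) : ¬ (l : ℤ) ∣ m * n :=
      hl'.not_dvd_mul hm hn
    have hnp {r : ℕ} (hr : r.Prime) (h : l ≠ r) : (r : ZMod l) ≠ 0 := fun h0 ↦
      h ((Nat.prime_dvd_prime_iff_eq hl hr).mp ((ZMod.natCast_eq_zero_iff _ _).mp h0))
    have h2 : (2 : ZMod l) ≠ 0 := by exact_mod_cast hnp Nat.prime_two hl2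
    have hbp' : (b : ZMod l) + 2 ≠ 0 := by
      have := hnp hp hlp
      have e := congrArg (Int.cast (R := ZMod l)) hbp
      push_cast at e
      rwa [e]
    have hbq' : (b : ZMod l) - 2 ≠ 0 := by
      have := hnp hq hlq
      have e := congrArg (Int.cast (R := ZMod l)) hbq
      push_cast at e
      rwa [e]
    have hφ := Rat.reduction_inv_eq_zero l
    have hm₁ : x₁ ∈ Rat.integralAt l :=
      Rat.mem_integralAt_of_mul (i := 4 * B ^ 2 - b ^ 2 * X ^ 2) (j := b * X ^ 2)
        (by push_cast; exact e₁) (hnd hlb (sq X ▸ hnd hlX hlX))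
    have hm₂ : x₂ ∈ Rat.integralAt l :=
      Rat.mem_integralAt_of_mul (i := 4 * B ^ 2 - b ^ 2 * Y ^ 2) (j := b * Y ^ 2)
        (by push_cast; exact e₂) (hnd hlb (sq Y ▸ hnd hlY hlY))
    have hk : Rat.reduction l (4 * ((b : Rat.integralAt l) ^ 2 - 4)) ≠ 0 := by
      simp only [map_mul, map_sub, map_pow, map_intCast, map_ofNat]
      rw [show (4 : ZMod l) * ((b : ZMod l) ^ 2 - 4) = 2 * 2 * ((b + 2) * (b - 2)) by ring]
      exact mul_ne_zero (mul_ne_zero h2 h2) (mul_ne_zero hbp' hbq')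
    have hx := hx hFl hm₁
    have hs₁ : Point.some x₁ y₁ hns₁ + Point.some x₁ y₁ hns₁ ∈ redKernel hφ := by
      refine isInfiniteMod_add_self hk hm₁ ?_
      rw [map_mul]
      rcases hc with rfl | rfl
      · refine mul_eq_zero_of_left ?_ _
        rw [← hx]
        congr 1
        push_cast
        ring
      · refine mul_eq_zero_of_right _ ?_
        rw [← hx]
        congr 1
        push_cast
        ring
    have hs₂ : Point.some x₂ y₂ hns₂ + Point.some x₂ y₂ hns₂ ∈ redKernel hφ := by
      refine isInfiniteMod_add_self hk hm₂ (Rat.reduction_eq_zero_of_mul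
        (i := 4 * B * (4 * B) * (Z ^ 2 * (X ^ 2 - A ^ 2)))
        (j := (b * Y ^ 2 * X) * (b * Y ^ 2 * X)) ?_ ?_ ?_)
      · push_cast
        have : (Z : ℚ) ^ 2 * (X ^ 2 - A ^ 2) = (B * X + A * Y) * (B * X - A * Y) := by
          have h₁ : (A : ℚ) ^ 2 + B ^ 2 = Z ^ 2 := by exact_mod_cast h₁
          have h₂ : (X : ℚ) ^ 2 + Y ^ 2 = Z ^ 2 := by exact_mod_cast h₂
          linear_combination A ^ 2 * h₂ - X ^ 2 * h₁
        rw [this, show ((2 : Rat.integralAt l) : ℚ) = 2 from rfl]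
        linear_combination (x₂ + b - 2) * (b * Y ^ 2 * X) * f₂ + 4 * B * (B * X + A * Y) * g₂
      · have := hnd (hnd hlb (sq Y ▸ hnd hlY hlY)) hlX
        exact hnd this this
      · exact ((dvd_pow hlZ two_ne_zero).mul_right _).mul_left _
    have hfin := add_self_mem_redKernel hφ hk
      (exists_eq_zsmul_add hb hab hp hq hbp hbq hq4) ht₁ ht₂ hR₁ hR₂ hs₁ hs₂
    have hdiff : R₁ + R₁ = Point.some x₁ y₁ hns₁ + t₁ := by
      rw [hR₁, add_right_comm, ht₁, zero_add]
    rw [hdiff] at hfin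
    rcases eq_zero_or_of_add_self_eq_zero ht₁ with rfl | ⟨e, he, rfl, hcase⟩
    · rw [add_zero] at hfin
      exact hfin hm₁
    · obtain ⟨e', rfl, hcase'⟩ : ∃ e' : ℤ, e = (e' : ℚ) ∧
          ((e' : ℤ) = 0 ∨ e' = 2 - b ∨ e' = -2 - b) := by
        rcases hcase with rfl | rfl | rfl
        · exact ⟨0, by simp, by simp⟩
        · exact ⟨2 - b, by simp, by simp⟩
        · exact ⟨-2 - b, by simp, by simp⟩
      have hec : e' ≠ c := fun h ↦ hct (h ▸ he) (by subst h; rfl)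
      refine not_isInfiniteMod_add hφ hm₁ (intCast_mem (Rat.integralAt l) e') ?_ hfin
      intro heq
      have heq : Rat.reduction l ⟨x₁, hm₁⟩ = (e' : ZMod l) := by
        rw [heq, ← map_intCast (Rat.reduction l)]
        rfl
      rw [map_sub, map_intCast, heq] at hx
      rcases hcase' with rfl | rfl | rfl <;> rcases hc with rfl | rfl
      · exact hbq' (by push_cast at hx; linear_combination hx)
      · exact hbp' (by push_cast at hx; linear_combination hx)
      · exact hec rfl
      · exact mul_ne_zero h2 h2 (by push_cast at hx; linear_combination hx)
      · exact mul_ne_zero h2 h2 (by push_cast at hx; linear_combination -hx)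
      · exact hec rfl
  have h₃' : 4 * (A ^ 2 * B ^ 2) = b ^ 2 * (X ^ 2 * Y ^ 2) := by
    linear_combination (2 * (A * B) + b * (X * Y)) * h₃
  have hdenom (l : ℕ) (hl : l.Prime) (hlZ : (l : ℤ) ∣ Z) : ¬ (l : ℤ) ∣ b * X ^ 2 * Y := by
    obtain ⟨hlX, hlY, hlb, -⟩ := hprime l hl hlZ
    have hl' := Nat.prime_iff_prime_int.mp hl
    exact hl'.not_dvd_mul (hl'.not_dvd_mul hlb fun h ↦ hlX (hl'.dvd_of_dvd_pow h)) hlY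
  by_cases hcase : ∃ h, t₁ = Point.some ((-2 - b : ℤ) : ℚ) 0 h
  · obtain ⟨l, hl, hlZ, hd⟩ := exists_prime_dvd_add hb (X := X) (Y := Y) (A := -A) (B := B)
      (by linear_combination h₁) h₂ (by linear_combination h₃') hX hY hAe.neg hBo hYo
    refine main l hl hlZ (2 - b) (.inl rfl) (fun _ hm ↦ ?_) ?_
    · refine Rat.reduction_eq_zero_of_mul (i := 4 * B * (B * Y - A * X)) (j := b * X ^ 2 * Y) ?_
        (hdenom l hl hlZ) (Dvd.dvd.mul_left (by rwa [neg_mul, ← sub_eq_add_neg] at hd) _)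
      push_cast
      rw [← g₁, show ((2 : Rat.integralAt l) : ℚ) = 2 from rfl]
      ring
    · rintro h rfl
      obtain ⟨h', heq⟩ := hcase
      rw [Point.some.injEq] at heq
      have := Int.cast_injective heq.1
      omega
  · obtain ⟨l, hl, hlZ, hd⟩ := exists_prime_dvd_add hb h₁ h₂ h₃' hX hY hAe hBo hYo
    refine main l hl hlZ (-2 - b) (.inr rfl) (fun _ hm ↦ ?_) fun h heq ↦ hcase ⟨h, heq⟩
    refine Rat.reduction_eq_zero_of_mul (i := 4 * B * (B * Y + A * X)) (j := b * X ^ 2 * Y) ?_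
      (hdenom l hl hlZ) (hd.mul_left _)
    push_cast
    rw [← f₁, show ((2 : Rat.integralAt l) : ℚ) = 2 from rfl]
    ring

end jacCurve

section Reduction

variable {a b X Y Z W : ℤ}

/-- A square value of `Z⁴ - b²X²Y²` at a Pythagorean triple gives a second Pythagorean triple. -/
lemma exists_pythagorean_of_sq_eq (hXe : Even X) (hXZ : IsCoprime X Z)
    (hYZ : IsCoprime Y Z) (hbZ : IsCoprime b Z) (hW : W ^ 2 = Z ^ 4 - b ^ 2 * (X ^ 2 * Y ^ 2)) :
    ∃ A B : ℤ, Even A ∧ A ^ 2 + B ^ 2 = Z ^ 2 ∧ 2 * (A * B) = b * (X * Y) := by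
  have hZo : Odd Z := by
    by_contra h
    exact absurd (hXZ.isUnit_of_dvd' hXe.two_dvd (Int.not_odd_iff_even.mp h).two_dvd) (by decide)
  have hZ : 0 < Z ^ 2 := by
    have : Z ≠ 0 := by rintro rfl; exact absurd hZo (by decide)
    positivity
  have hev : Even (b * (X * Y)) := (hXe.mul_right Y).mul_left b
  have hmo : Odd (Z ^ 2 - b * (X * Y)) := hZo.pow.sub_even hev
  have hno : Odd (Z ^ 2 + b * (X * Y)) := hZo.pow.add_even hev
  have hco : IsCoprime (Z ^ 2 - b * (X * Y)) (Z ^ 2 + b * (X * Y)) := by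
    have h1 : IsCoprime (Z ^ 2 - b * (X * Y)) (Z ^ 2) := by
      have : IsCoprime (-(b * (X * Y))) (Z ^ 2) := (hbZ.mul_left (hXZ.mul_left hYZ)).pow_right.neg_left
      simpa [sub_eq_neg_add] using this.add_mul_left_left 1
    have h2 : IsCoprime (Z ^ 2 - b * (X * Y)) 2 := Int.isCoprime_two_right.mpr hmo
    rw [show Z ^ 2 + b * (X * Y) = 2 * Z ^ 2 + (Z ^ 2 - b * (X * Y)) * (-1) by ring]
    exact (h2.mul_right h1).add_mul_left_right (-1)
  have hprod : (Z ^ 2 - b * (X * Y)) * (Z ^ 2 + b * (X * Y)) = W ^ 2 := by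
    linear_combination -hW
  obtain ⟨S, hS⟩ : ∃ S, Z ^ 2 - b * (X * Y) = S ^ 2 := by
    obtain ⟨S, hS | hS⟩ := Int.sq_of_isCoprime hco hprod
    · exact ⟨S, hS⟩
    · exfalso
      have hS0 : S ≠ 0 := by rintro rfl; exact absurd (hS ▸ hmo) (by decide)
      have : 0 < S ^ 2 := by positivity
      nlinarith [sq_nonneg W]
  obtain ⟨T, hT⟩ : ∃ T, Z ^ 2 + b * (X * Y) = T ^ 2 := by
    obtain ⟨T, hT | hT⟩ := Int.sq_of_isCoprime hco.symm ((mul_comm _ _).trans hprod)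
    · exact ⟨T, hT⟩
    · exfalso
      have hT0 : T ≠ 0 := by rintro rfl; exact absurd (hT ▸ hno) (by decide)
      have : 0 < T ^ 2 := by positivity
      nlinarith [sq_nonneg W]
  have hSo : Odd S := Int.odd_pow' two_ne_zero |>.mp (hS ▸ hmo)
  have hTo : Odd T := Int.odd_pow' two_ne_zero |>.mp (hT ▸ hno)
  obtain ⟨A, hA⟩ := (hTo.sub_odd hSo).two_dvd
  obtain ⟨B, hB⟩ := (hTo.add_odd hSo).two_dvd
  obtain rfl : T = A + B := by omega
  obtain rfl : S = B - A := by omega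
  have h₁ : A ^ 2 + B ^ 2 = Z ^ 2 := by linarith
  have h₃ : 2 * (A * B) = b * (X * Y) := by linarith
  rcases Int.even_or_odd A with hAe | hAo
  · exact ⟨A, B, hAe, h₁, h₃⟩
  · have hBe : Even B := by
      by_contra h
      exact Int.not_even_iff_odd.mpr hTo (hAo.add_odd (Int.not_even_iff_odd.mp h))
    exact ⟨B, A, hBe, by linarith, by linarith⟩

lemma not_sq_eq_of_pythagorean {p q : ℕ} (hab : b = a ^ 2) (hp : p.Prime) (hq : q.Prime)
    (hbp : b + 2 = p) (hbq : b - 2 = q) (hq4 : q % 4 = 3)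
    (hl4 : ∀ l : ℕ, l.Prime → (l : ℤ) ∣ a → l % 4 = 3)
    (h₂ : X ^ 2 + Y ^ 2 = Z ^ 2) (hX : X ≠ 0) (hY : Y ≠ 0) (hco : IsCoprime X Z) :
    W ^ 2 ≠ Z ^ 4 - b ^ 2 * (X ^ 2 * Y ^ 2) := by
  intro hW
  have hYZ : IsCoprime Y Z := by
    have h : IsCoprime (X ^ 2) (Z ^ 2) := hco.pow
    have h' := h.neg_left.add_mul_left_left 1
    rw [show -X ^ 2 + Z ^ 2 * 1 = Y ^ 2 by linarith] at h'
    exact (IsCoprime.pow_iff two_pos two_pos).mp h'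
  have hbZ : IsCoprime b Z := by
    rw [hab]
    refine IsCoprime.pow_left (Int.isCoprime_iff_gcd_eq_one.mpr ?_)
    by_contra hg
    obtain ⟨l, hl, hlg⟩ := Nat.exists_prime_and_dvd hg
    have hla : (l : ℤ) ∣ a := (Int.natCast_dvd_natCast.mpr hlg).trans (Int.gcd_dvd_left _ _)
    have hlZ : (l : ℤ) ∣ Z := (Int.natCast_dvd_natCast.mpr hlg).trans (Int.gcd_dvd_right _ _)
    have : Fact l.Prime := ⟨hl⟩
    have hlY : ¬ (l : ℤ) ∣ Y := fun hlY ↦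
      hl.ne_one (by simpa using Int.isUnit_iff_natAbs_eq.mp (hYZ.isUnit_of_dvd' hlY hlZ))
    refine ZMod.mod_four_ne_three_of_sq_eq_neg_sq' (x := (X : ZMod l)) (y := (Y : ZMod l))
      (fun h0 ↦ hlY ((ZMod.intCast_zmod_eq_zero_iff_dvd _ _).mp h0)) ?_ (hl4 l hl hla)
    have e := congrArg (Int.cast (R := ZMod l)) h₂
    push_cast at e
    rw [(ZMod.intCast_zmod_eq_zero_iff_dvd _ _).mpr hlZ] at e
    linear_combination e
  rcases Int.even_or_odd X with hXe | hXo
  · obtain ⟨A, B, hAe, h₁, h₃⟩ := exists_pythagorean_of_sq_eq hXe hco hYZ hbZ hW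
    exact jacCurve.false_of_quadruple hab hp hq hbp hbq hq4 hl4 h₁ h₂ h₃ hX hY hXe hAe hco
  · have hYe : Even Y := by
      by_contra h
      rw [Int.not_even_iff_odd] at h
      have h1 := Int.sq_mod_four_eq_one_of_odd hXo
      have h2 := Int.sq_mod_four_eq_one_of_odd h
      rcases Int.even_or_odd Z with ⟨z, rfl⟩ | hZ
      · ring_nf at h₂; omega
      · have h3 := Int.sq_mod_four_eq_one_of_odd hZ
        omega
    obtain ⟨A, B, hAe, h₁, h₃⟩ := exists_pythagorean_of_sq_eq hYe hYZ hco hbZ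
      (W := W) (by linear_combination hW)
    exact jacCurve.false_of_quadruple hab hp hq hbp hbq hq4 hl4 h₁
      (by linear_combination h₂) h₃ hY hX hYe hAe hYZ

lemma Rat.exists_int_eq_of_sq_eq {r : ℚ} {n : ℤ} (h : r ^ 2 = n) : ∃ m : ℤ, r = m := by
  obtain ⟨m, hm⟩ := Rat.isSquare_intCast_iff.mp (⟨r, by rw [← h, sq]⟩ : IsSquare (n : ℚ))
  have : r ^ 2 = (m : ℚ) ^ 2 := by rw [h, hm]; push_cast; ring
  rcases sq_eq_sq_iff_eq_or_eq_neg.mp this with h | h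
  · exact ⟨m, h⟩
  · exact ⟨-m, by simpa using h⟩

lemma not_sq_eq_of_circle {p q : ℕ} (hab : b = a ^ 2) (hp : p.Prime) (hq : q.Prime)
    (hbp : b + 2 = p) (hbq : b - 2 = q) (hq4 : q % 4 = 3)
    (hl4 : ∀ l : ℕ, l.Prime → (l : ℤ) ∣ a → l % 4 = 3) {u v w : ℚ}
    (huv : u ^ 2 + v ^ 2 = 1) (hu : u ≠ 0) (hv : v ≠ 0) :
    w ^ 2 ≠ 1 - b ^ 2 * (u ^ 2 * v ^ 2) := by
  intro hw
  have hZ : (u.den : ℚ) ≠ 0 := by simp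
  have huX : u * u.den = u.num := Rat.mul_den_eq_num u
  obtain ⟨Y, hY⟩ := Rat.exists_int_eq_of_sq_eq (r := v * u.den)
    (n := (u.den : ℤ) ^ 2 - u.num ^ 2) (by
      push_cast
      rw [← huX]
      linear_combination (u.den : ℚ) ^ 2 * huv)
  obtain ⟨W, hW⟩ := Rat.exists_int_eq_of_sq_eq (r := w * u.den ^ 2)
    (n := (u.den : ℤ) ^ 4 - b ^ 2 * (u.num ^ 2 * Y ^ 2)) (by
      push_cast
      rw [← huX, ← hY]
      linear_combination (u.den : ℚ) ^ 4 * hw)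
  refine not_sq_eq_of_pythagorean hab hp hq hbp hbq hq4 hl4 (X := u.num) (Y := Y) (Z := u.den)
    (W := W) ?_ (Rat.num_ne_zero.mpr hu) ?_ ?_ ?_
  · rw [← Int.cast_inj (α := ℚ)]
    push_cast
    rw [← huX, ← hY]
    linear_combination (u.den : ℚ) ^ 2 * huv
  · rintro rfl
    exact mul_ne_zero hv hZ (by simpa using hY)
  · exact Int.isCoprime_iff_nat_coprime.mpr (by simpa using u.reduced)
  · rw [← Int.cast_inj (α := ℚ)]
    push_cast
    rw [← huX, ← hY, ← hW]
    linear_combination (u.den : ℚ) ^ 4 * hw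

end Reduction

/-- The affine rational points of the genus 3 hyperelliptic curve `C₂₃₇ :
y² = x⁸ + (4 - 4·237⁴)x⁶ + (8·237⁴ + 6)x⁴ + (4 - 4·237⁴)x² + 1` are exactly
`(±1, ±4)` and `(0, ±1)`. -/
theorem affine_points_C237 :
    {p : ℚ × ℚ | p.2 ^ 2 = p.1 ^ 8 + (4 - 4 * (237 : ℚ) ^ 4) * p.1 ^ 6
        + (8 * (237 : ℚ) ^ 4 + 6) * p.1 ^ 4 + (4 - 4 * (237 : ℚ) ^ 4) * p.1 ^ 2 + 1} =
      {(1, 4), (1, -4), (-1, 4), (-1, -4), (0, 1), (0, -1)} := by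
  ext ⟨x, y⟩
  simp only [Set.mem_ofPred_eq, Set.mem_insert_iff, Set.mem_singleton_iff, Prod.mk.injEq]
  constructor
  · intro h
    by_cases hx0 : x = 0
    · subst hx0
      have : y ^ 2 = 1 ^ 2 := by linarith
      rcases sq_eq_sq_iff_eq_or_eq_neg.mp this with rfl | rfl <;> simp
    by_cases hx1 : x ^ 2 = 1
    · have : y ^ 2 = 4 ^ 2 := by
        rw [h]
        linear_combination (x ^ 6 + (5 - 4 * 237 ^ 4) * x ^ 4 + (11 + 4 * 237 ^ 4) * x ^ 2 + 15) * hx1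
      rcases sq_eq_sq_iff_eq_or_eq_neg.mp this with rfl | rfl <;>
        rcases sq_eq_sq_iff_eq_or_eq_neg.mp (hx1.trans (one_pow 2).symm) with rfl | rfl <;> simp
    exfalso
    have hs : x ^ 2 + 1 ≠ 0 := by positivity
    refine not_sq_eq_of_circle (a := 237) (b := 56169) (p := 56171) (q := 56167) (by norm_num)
      (by norm_num) (by norm_num) (by norm_num) (by norm_num) (by norm_num) ?_
      (u := 2 * x / (x ^ 2 + 1)) (v := (x ^ 2 - 1) / (x ^ 2 + 1)) (w := y / (x ^ 2 + 1) ^ 2)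
      ?_ (by positivity) (div_ne_zero (sub_ne_zero.mpr hx1) hs) ?_
    · intro l hl hla
      have hla : l ∣ 3 * 79 := by exact_mod_cast hla
      rcases (hl.dvd_mul).mp hla with h | h
      · rw [(Nat.prime_dvd_prime_iff_eq hl (by norm_num)).mp h]
      · rw [(Nat.prime_dvd_prime_iff_eq hl (by norm_num)).mp h]
    · field_simp
      ring
    · push_cast
      field_simp
      linear_combination h
  · rintro (⟨rfl, rfl⟩ | ⟨rfl, rfl⟩ | ⟨rfl, rfl⟩ | ⟨rfl, rfl⟩ | ⟨rfl, rfl⟩ | ⟨rfl, rfl⟩) <;> norm_num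
end
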